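/- arXiv:2206.14910 — 14 statements merged into one kernel-verified Lean document; each statement's English description precedes it below -/
import Mathlib

section
/- Let p ≥ 5 and q ≥ 5 be integers (so in particular (p−2)(q−2) > 4). Then the simple continued fraction expansion of β is [q−3; 1, p−4, 1, q−4, 1, p−4, 1, q−4, …]; that is, the integer part of β is b₀ = q−3, and for i ≥ 1 the i-th partial denominator of the continued fraction of β equals 1 when i is odd, equals p−4 when i ≡ 2 (mod 4), and equals q−4 when i ≡ 0 (mod 4). -/
/-- `β = ((p−2)(q−2) + √((p−2)²(q−2)² − 4(p−2)(q−2)))/(2(p−2))`. -/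
noncomputable def hypBeta (p q : ℕ) : ℝ :=
  (((p : ℝ) - 2) * ((q : ℝ) - 2) +
      Real.sqrt (((p : ℝ) - 2) ^ 2 * ((q : ℝ) - 2) ^ 2 -
        4 * (((p : ℝ) - 2) * ((q : ℝ) - 2)))) / (2 * ((p : ℝ) - 2))

/-- The sequence of complete quotients of the standard continued fraction algorithm:
`x₀ = x`, `x_{i+1} = 1/(x_i − ⌊x_i⌋)`.  The `i`-th partial denominator is `⌊x_i⌋`. -/
noncomputable def cfX (x : ℝ) : ℕ → ℝ
  | 0 => x
  | n + 1 => (cfX x n - ⌊cfX x n⌋)⁻¹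

theorem aux_floor (n : ℤ) (a b : ℝ) (hb : 2 < b) (h : a = n - 1 / b) :
    ⌊a⌋ = n - 1 ∧ (a - ⌊a⌋)⁻¹ = b / (b - 1) := by
  have h1 : 0 < 1 / b := by positivity
  have h2 : 1 / b < 1 := by rw [div_lt_one (by linarith)]; linarith
  have hf : ⌊a⌋ = n - 1 := by
    rw [Int.floor_eq_iff]; push_cast; constructor <;> linarith
  refine ⟨hf, ?_⟩
  rw [hf, h]; push_cast
  have : b ≠ 0 := by linarith
  have : b - 1 ≠ 0 := by linarith
  have e : (n : ℝ) - 1 / b - (n - 1) = (b - 1) / b := by field_simp; ring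
  rw [e, inv_div]

theorem aux_one (b : ℝ) (hb : 2 < b) :
    ⌊b / (b - 1)⌋ = 1 ∧ (b / (b - 1) - ⌊b / (b - 1)⌋)⁻¹ = b - 1 := by
  have h0 : 0 < b - 1 := by linarith
  have hf : ⌊b / (b - 1)⌋ = 1 := by
    rw [Int.floor_eq_iff]; push_cast
    constructor
    · rw [le_div_iff₀ h0]; linarith
    · rw [div_lt_iff₀ h0]; linarith
  refine ⟨hf, ?_⟩
  rw [hf]; push_cast
  have e : b / (b - 1) - 1 = 1 / (b - 1) := by field_simp; ring
  rw [e, one_div, inv_inv]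

theorem aux_beta (p q : ℕ) (hp : 5 ≤ p) (hq : 5 ≤ q) :
    ∃ b : ℝ, 2 < b ∧ 2 < hypBeta p q ∧ hypBeta p q = ((q - 2 : ℤ) : ℝ) - 1 / b ∧
      b = ((p - 2 : ℤ) : ℝ) - 1 / hypBeta p q := by
  have hP : (3 : ℝ) ≤ (p : ℝ) - 2 := by
    have : (5 : ℝ) ≤ p := by exact_mod_cast hp
    linarith
  have hQ : (3 : ℝ) ≤ (q : ℝ) - 2 := by
    have : (5 : ℝ) ≤ q := by exact_mod_cast hq
    linarith
  have c1 : ((p - 2 : ℤ) : ℝ) = (p : ℝ) - 2 := by push_cast; ring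
  have c2 : ((q - 2 : ℤ) : ℝ) = (q : ℝ) - 2 := by push_cast; ring
  rw [c1, c2]
  clear c1 c2
  unfold hypBeta
  generalize (p : ℝ) - 2 = P at *
  generalize (q : ℝ) - 2 = Q at *
  have hPQ : 9 ≤ P * Q := by nlinarith
  have hD : 0 ≤ P ^ 2 * Q ^ 2 - 4 * (P * Q) := by nlinarith
  have hs := Real.sq_sqrt hD
  have hs0 := Real.sqrt_nonneg (P ^ 2 * Q ^ 2 - 4 * (P * Q))
  generalize Real.sqrt (P ^ 2 * Q ^ 2 - 4 * (P * Q)) = s at *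
  have hP0 : 0 < P := by linarith
  obtain ⟨x, hx⟩ : ∃ x, x = (P * Q + s) / (2 * P) := ⟨_, rfl⟩
  rw [← hx]
  have hx2 : 2 * P * x = P * Q + s := by rw [hx]; field_simp
  have hquad : P * x ^ 2 - P * Q * x + Q = 0 := by
    have : 4 * P * (P * x ^ 2 - P * Q * x + Q) = 0 := by
      have : s = 2 * P * x - P * Q := by linarith
      rw [this] at hs
      linarith
    rcases mul_eq_zero.1 this with h | h
    · linarith
    · exact h
  have hx1 : 1 < x := by nlinarith
  have hx0 : 0 < x := by linarith
  have hi : 1 / x < 1 := by rw [div_lt_one hx0]; exact hx1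
  have hb : 2 < P - 1 / x := by linarith
  have e : x = Q - 1 / (P - 1 / x) := by
    have h3 : P - 1 / x ≠ 0 := by linarith
    have h4 : (Q - x) * (P - 1 / x) = 1 := by
      field_simp
      linarith
    have : Q - x = 1 / (P - 1 / x) := by rw [eq_div_iff h3]; exact h4
    linarith
  refine ⟨P - 1 / x, hb, ?_, e, rfl⟩
  have : 1 / (P - 1 / x) < 1 := by rw [div_lt_one (by linarith)]; linarith
  linarith

theorem cf_beta_p_ge5_q_ge5 (p q : ℕ) (hp : 5 ≤ p) (hq : 5 ≤ q) :
    ⌊cfX (hypBeta p q) 0⌋ = (q : ℤ) - 3 ∧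
    ∀ i : ℕ, 1 ≤ i →
      (i % 2 = 1 → ⌊cfX (hypBeta p q) i⌋ = 1) ∧
      (i % 4 = 2 → ⌊cfX (hypBeta p q) i⌋ = (p : ℤ) - 4) ∧
      (i % 4 = 0 → ⌊cfX (hypBeta p q) i⌋ = (q : ℤ) - 4) := by
  obtain ⟨b, hb, ha, h1, h2⟩ := aux_beta p q hp hq
  generalize hypBeta p q = a at *
  obtain ⟨f0, g0⟩ := aux_floor _ a b hb h1
  obtain ⟨f1, g1⟩ := aux_one b hb
  obtain ⟨f2, g2⟩ := aux_floor (p - 2 - 1) (b - 1) a ha (by push_cast at *; linarith)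
  obtain ⟨f3, g3⟩ := aux_one a ha
  obtain ⟨f4, g4⟩ := aux_floor (q - 2 - 1) (a - 1) b hb (by push_cast at *; linarith)
  have key : ∀ k : ℕ, cfX a (4 * k + 1) = b / (b - 1) ∧ cfX a (4 * k + 2) = b - 1 ∧
      cfX a (4 * k + 3) = a / (a - 1) ∧ cfX a (4 * k + 4) = a - 1 := by
    have step : ∀ n, cfX a n = b / (b - 1) → cfX a n = b / (b - 1) ∧ cfX a (n + 1) = b - 1 ∧
      cfX a (n + 2) = a / (a - 1) ∧ cfX a (n + 3) = a - 1 := by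
      intro n hn
      have e1 : cfX a (n + 1) = b - 1 := by rw [cfX, hn, g1]
      have e2 : cfX a (n + 2) = a / (a - 1) := by rw [cfX, e1, g2]
      have e3 : cfX a (n + 3) = a - 1 := by rw [cfX, e2, g3]
      exact ⟨hn, e1, e2, e3⟩
    intro k
    induction k with
    | zero => exact step 1 (by rw [cfX, cfX, g0])
    | succ k ih => exact step (4 * k + 4 + 1) (by rw [cfX, ih.2.2.2, g4])
  refine ⟨by rw [cfX, f0]; ring, fun i hi => ?_⟩
  obtain ⟨k, hk⟩ : ∃ k, i = 4 * k + 1 ∨ i = 4 * k + 2 ∨ i = 4 * k + 3 ∨ i = 4 * k + 4 :=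
    ⟨(i - 1) / 4, by omega⟩
  obtain ⟨k1, k2, k3, k4⟩ := key k
  rcases hk with rfl | rfl | rfl | rfl
  · rw [k1, f1]; refine ⟨fun _ => rfl, fun h => ?_, fun h => ?_⟩ <;> omega
  · rw [k2, f2]; refine ⟨fun h => ?_, fun h => ?_, fun h => ?_⟩ <;> omega
  · rw [k3, f3]; refine ⟨fun _ => rfl, fun h => ?_, fun h => ?_⟩ <;> omega
  · rw [k4, f4]; refine ⟨fun h => ?_, fun h => ?_, fun h => ?_⟩ <;> omega
end

section
/- Let p = 3 and q ≥ 7 be integers. Then the simple continued fraction expansion of β is [q−4; 1, q−6, 1, q−6, …]; that is, the integer part of β is b₀ = q−4, and for i ≥ 1 the i-th partial denominator equals 1 when i is odd and equals q−6 when i is even. -/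
theorem hypBeta3_aux (q : ℕ) (hq : 7 ≤ q) : ∃ t : ℝ, 0 < t ∧ t < 1 ∧
    t ^ 2 + ((q : ℝ) - 6) * t = (q : ℝ) - 6 ∧ hypBeta 3 q = t + ((q : ℝ) - 4) := by
  have h7 : (7 : ℝ) ≤ q := by exact_mod_cast hq
  have hnn : (0 : ℝ) ≤ ((q : ℝ) - 2) ^ 2 - 4 * ((q : ℝ) - 2) := by nlinarith
  have hs := Real.sq_sqrt hnn
  have hs0 := Real.sqrt_nonneg (((q : ℝ) - 2) ^ 2 - 4 * ((q : ℝ) - 2))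
  have hb : hypBeta 3 q =
      (((q : ℝ) - 2) + Real.sqrt (((q : ℝ) - 2) ^ 2 - 4 * ((q : ℝ) - 2))) / 2 := by
    unfold hypBeta
    norm_num
  rw [hb]
  set s := Real.sqrt (((q : ℝ) - 2) ^ 2 - 4 * ((q : ℝ) - 2))
  refine ⟨(s - (q - 6)) / 2, ?_, ?_, ?_, ?_⟩
  · have : (q : ℝ) - 6 < s := by nlinarith
    linarith
  · have : s < (q : ℝ) - 4 := by nlinarith
    linarith
  · nlinarith
  · ring

/-- For `p = 3`, `q ≥ 7`, the continued fraction expansion of `β` is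
`[q−4; 1, q−6, 1, q−6, …]`. -/
theorem cf_beta_p_eq3 (q : ℕ) (hq : 7 ≤ q) :
    ⌊cfX (hypBeta 3 q) 0⌋ = (q : ℤ) - 4 ∧
    ∀ i : ℕ, 1 ≤ i →
      (i % 2 = 1 → ⌊cfX (hypBeta 3 q) i⌋ = 1) ∧
      (i % 2 = 0 → ⌊cfX (hypBeta 3 q) i⌋ = (q : ℤ) - 6) := by
  have h7 : (7 : ℝ) ≤ q := by exact_mod_cast hq
  obtain ⟨t, ht0, ht1, ht, hb⟩ := hypBeta3_aux q hq
  have f0 : ⌊cfX (hypBeta 3 q) 0⌋ = (q : ℤ) - 4 := by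
    rw [Int.floor_eq_iff]
    simp only [cfX, hb]
    push_cast
    constructor <;> linarith
  have ht2 : 1 < 2 * t := by nlinarith
  have fu : ⌊t⁻¹⌋ = 1 := by
    rw [Int.floor_eq_iff]
    push_cast
    constructor
    · exact (one_lt_inv₀ ht0).2 ht1 |>.le
    · rw [inv_lt_comm₀ ht0 (by norm_num)]
      linarith
  have fv : ⌊t + ((q : ℝ) - 6)⌋ = (q : ℤ) - 6 := by
    rw [Int.floor_eq_iff]
    push_cast
    constructor <;> linarith
  have key : ∀ k : ℕ, cfX (hypBeta 3 q) (2 * k + 1) = t⁻¹ ∧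
      cfX (hypBeta 3 q) (2 * k + 2) = t + ((q : ℝ) - 6) := by
    have step : ∀ n, cfX (hypBeta 3 q) n = t⁻¹ →
        cfX (hypBeta 3 q) (n + 1) = t + ((q : ℝ) - 6) := by
      intro n hn
      rw [cfX, hn, fu]
      have h1 : t⁻¹ - ((1 : ℤ) : ℝ) = (1 - t) / t := by
        push_cast
        field_simp
      have h2 : 1 - t ≠ 0 := by linarith
      rw [h1, inv_div, div_eq_iff h2]
      nlinarith
    intro k
    induction k with
    | zero =>
      have h1 : cfX (hypBeta 3 q) 1 = t⁻¹ := by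
        rw [cfX, f0]
        simp [cfX, hb]
      exact ⟨h1, step _ h1⟩
    | succ k ih =>
      have h1 : cfX (hypBeta 3 q) (2 * (k + 1) + 1) = t⁻¹ := by
        show cfX (hypBeta 3 q) (2 * k + 2 + 1) = t⁻¹
        rw [cfX, ih.2, fv]
        push_cast
        congr 1
        ring
      exact ⟨h1, step _ h1⟩
  refine ⟨f0, fun i hi => ⟨fun h => ?_, fun h => ?_⟩⟩
  · obtain ⟨k, rfl⟩ : ∃ k, i = 2 * k + 1 := ⟨i / 2, by omega⟩
    rw [(key k).1, fu]
  · obtain ⟨k, rfl⟩ : ∃ k, i = 2 * k + 2 := ⟨i / 2 - 1, by omega⟩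
    rw [(key k).2, fv]
end

section
/- Let p ≥ 4 and q ≥ 4 be integers with (p−2)(q−2) > 4. Then for every k ≥ 1 and every index i with 1 ≤ i ≤ length(W_k), the i-th letter of the word W_k equals q − ⌊iβ⌋ + ⌊(i−1)β⌋. (Since each W_k is a prefix of W_{k+1}, this gives the i-th letter of the limit word W = lim_{k→∞} W_k.) -/
/-- `a`-fold concatenation of a word. -/
def wpow (X : List ℕ) (a : ℕ) : List ℕ := (List.replicate a X).flatten

/-- For `p ≥ 4`, `q ≥ 4`: `UW p q k = (U_{k+1}, W_{k+1})`, where `U_1 = (2)`, `W_1 = (3)`,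
`U_{k+1} = W_k U_k^{p−4} (W_k U_k^{p−3})^{q−3}` and `W_{k+1} = W_k U_k^{p−4} (W_k U_k^{p−3})^{q−4}`. -/
def UW (p q : ℕ) : ℕ → List ℕ × List ℕ
  | 0 => ([2], [3])
  | k + 1 =>
      ((UW p q k).2 ++ wpow (UW p q k).1 (p - 4) ++
        wpow ((UW p q k).2 ++ wpow (UW p q k).1 (p - 3)) (q - 3),
       (UW p q k).2 ++ wpow (UW p q k).1 (p - 4) ++
        wpow ((UW p q k).2 ++ wpow (UW p q k).1 (p - 3)) (q - 4))

/-- greedy run of a word from height `h` to height `h'` -/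
def RunW (e : ℝ) : List ℕ → ℝ → ℝ → Prop
  | [], h, h' => h' = h
  | a :: l, h, h' => (a = 3 ∧ 0 ≤ h ∧ h < e ∧ RunW e l (h + 1 - e) h') ∨
      (a = 2 ∧ e ≤ h ∧ h < 1 ∧ RunW e l (h - e) h')

lemma RunW.append {e : ℝ} {X Y : List ℕ} {a b c : ℝ} (h1 : RunW e X a b) (h2 : RunW e Y b c) :
    RunW e (X ++ Y) a c := by
  induction X generalizing a with
  | nil => simp only [RunW] at h1; subst h1; simpa using h2
  | cons x l ih =>
    simp only [RunW, List.cons_append] at h1 ⊢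
    rcases h1 with ⟨h, h', h'', h3⟩ | ⟨h, h', h'', h3⟩
    · exact Or.inl ⟨h, h', h'', ih h3⟩
    · exact Or.inr ⟨h, h', h'', ih h3⟩

lemma RunW_pow {e lo hi d : ℝ} {X : List ℕ} (hd : 0 ≤ d)
    (H : ∀ h, lo ≤ h → h < hi → RunW e X h (h - d)) (a : ℕ) :
    ∀ h, h < hi → lo - d ≤ h - a * d → RunW e (wpow X a) h (h - a * d) := by
  induction a with
  | zero => intro h _ _; simp [_root_.wpow, RunW]
  | succ a ih =>
    intro h h1 h2
    have had : 0 ≤ (a : ℝ) * d := by positivity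
    push_cast at h2 ⊢
    have e1 : _root_.wpow X (a + 1) = X ++ _root_.wpow X a := by
      simp [_root_.wpow, List.replicate_succ]
    rw [e1]
    refine (H h (by linarith) h1).append ?_
    have := ih (h - d) (by linarith) (by linarith)
    convert this using 1
    ring

lemma RunW.letter {e b : ℝ} {q : ℕ} (he : e = (q : ℝ) - 2 - b) (he0 : 0 < e) (he1 : e < 1)
    (X : List ℕ) : ∀ (h h' : ℝ) (n : ℕ) (c : ℤ) (j : ℕ), h = c - n * e → RunW e X h h' →
      j < X.length → ((X.getD j 0 : ℕ) : ℤ) =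
        (q : ℤ) - ⌊((n : ℝ) + j + 1) * b⌋ + ⌊((n : ℝ) + j) * b⌋ := by
  induction X with
  | nil => intro h h' n c j _ _ hj; simp at hj
  | cons x l ih =>
    intro h h' n c j hc hR hj
    have hb : b = (q : ℝ) - 2 - e := by linarith
    simp only [RunW] at hR
    cases j with
    | zero =>
      have f0 : ⌊(n : ℝ) * b⌋ = (n : ℤ) * (q - 2) - c := by
        rw [Int.floor_eq_iff]; push_cast; rw [hb]
        rcases hR with ⟨_, h1, h2, _⟩ | ⟨_, h1, h2, _⟩ <;> constructor <;> nlinarith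
      rcases hR with ⟨hx, h1, h2, _⟩ | ⟨hx, h1, h2, _⟩
      · have f1 : ⌊((n : ℝ) + 1) * b⌋ = ((n : ℤ) + 1) * (q - 2) - (c + 1) := by
          rw [Int.floor_eq_iff]; push_cast; rw [hb]
          constructor <;> nlinarith
        simp only [Nat.cast_zero, add_zero, f0, f1, hx, List.getD_cons_zero]
        push_cast; ring
      · have f1 : ⌊((n : ℝ) + 1) * b⌋ = ((n : ℤ) + 1) * (q - 2) - c := by
          rw [Int.floor_eq_iff]; push_cast; rw [hb]
          constructor <;> nlinarith
        simp only [Nat.cast_zero, add_zero, f0, f1, hx, List.getD_cons_zero]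
        push_cast; ring
    | succ j =>
      have hj' : j < l.length := by simpa using hj
      have key : ((l.getD j 0 : ℕ) : ℤ) =
        (q : ℤ) - ⌊(((n + 1 : ℕ) : ℝ) + j + 1) * b⌋ + ⌊(((n + 1 : ℕ) : ℝ) + j) * b⌋ := by
        rcases hR with ⟨hx, h1, h2, h3⟩ | ⟨hx, h1, h2, h3⟩
        · exact ih _ h' (n + 1) (c + 1) j (by push_cast; rw [hc]; ring) h3 hj'
        · exact ih _ h' (n + 1) c j (by push_cast; rw [hc]; ring) h3 hj'
      rw [List.getD_cons_succ, key]
      push_cast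
      have e1 : (n : ℝ) + (j + 1) + 1 = n + 1 + j + 1 := by ring
      have e2 : (n : ℝ) + (j + 1) = n + 1 + j := by ring
      rw [e1, e2]

lemma RunW_main {e t : ℝ} (m n : ℕ) (he0 : 0 < e) (he1 : e < 1) (ht0 : 0 < t) (ht1 : t < 1)
    (h1 : t = (m + 2) * e - 1) (h2 : (n + 2) * t = e * (1 + t)) (k : ℕ) :
    (∀ h, 0 ≤ h → h < t ^ k * e → RunW e (UW (m + 4) (n + 4) k).2 h (h + t ^ k * (1 - e))) ∧
    (∀ h, t ^ k * e ≤ h → h < t ^ k → RunW e (UW (m + 4) (n + 4) k).1 h (h - t ^ k * e)) := by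
  have hn : (0 : ℝ) ≤ n := by positivity
  have hte : t < e := by nlinarith
  induction k with
  | zero =>
    constructor
    · intro h a b
      simp only [_root_.UW, RunW]
      left; refine ⟨trivial, a, by simpa using b, by ring⟩
    · intro h a b
      simp only [_root_.UW, RunW]
      right; refine ⟨trivial, by simpa using a, by simpa using b, by ring⟩
  | succ k ih =>
    obtain ⟨ihW, ihU⟩ := ih
    set W := (_root_.UW (m + 4) (n + 4) k).2 with hW
    set U := (_root_.UW (m + 4) (n + 4) k).1 with hU
    have hs : 0 < t ^ k := by positivity
    set s := t ^ k with hsdef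
    have hse : 0 < s * e := by positivity
    have hst : 0 < s * t := by positivity
    have hste : 0 < s * t * e := by positivity
    have hstlt : s * t < s * e := by nlinarith
    have hstlt' : s * t * e < s * t := by nlinarith
    have g1 : s * t = m * (s * e) + 2 * (s * e) - s := by rw [h1]; ring
    have g2 : n * (s * t) + 2 * (s * t) = s * e + s * t * e := by linear_combination s * h2
    have P1 := RunW_pow hse.le ihU
    -- prefix W U^m
    have A : ∀ h, 0 ≤ h → h < s * e → RunW e (W ++ wpow U m) h (h + s * e - s * t) := by
      intro h a b
      refine (ihW h a b).append ?_
      have := P1 m (h + s * (1 - e)) (by linarith) (by linarith)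
      convert this using 1
      linarith
    have B : ∀ h, s * t ≤ h → h < s * e → RunW e (W ++ wpow U (m + 1)) h (h - s * t) := by
      intro h a b
      refine (ihW h (by linarith) b).append ?_
      have := P1 (m + 1) (h + s * (1 - e)) (by linarith) (by push_cast; linarith)
      convert this using 1
      push_cast
      linarith
    have C := RunW_pow hst.le B
    have ps : t ^ (k + 1) = s * t := pow_succ t k
    rw [ps]
    constructor
    · intro h a b
      have : (_root_.UW (m + 4) (n + 4) (k + 1)).2 =
        W ++ wpow U m ++ wpow (W ++ wpow U (m + 1)) n := rfl
      rw [this]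
      refine (A h a (by linarith)).append ?_
      have := C n (h + s * e - s * t) (by linarith) (by linarith)
      convert this using 1
      linarith
    · intro h a b
      have : (_root_.UW (m + 4) (n + 4) (k + 1)).1 =
        W ++ wpow U m ++ wpow (W ++ wpow U (m + 1)) (n + 1) := rfl
      rw [this]
      refine (A h (by linarith) (by linarith)).append ?_
      have := C (n + 1) (h + s * e - s * t) (by linarith) (by push_cast; linarith)
      convert this using 1
      push_cast
      linarith

/-- For `p ≥ 4`, `q ≥ 4` with `(p−2)(q−2) > 4`, the `i`-th letter of `W_k` equals
`q − ⌊iβ⌋ + ⌊(i−1)β⌋`. -/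
theorem W_letter_formula (p q : ℕ) (hp : 4 ≤ p) (hq : 4 ≤ q)
    (hpq : 4 < (p - 2) * (q - 2)) (k : ℕ) (hk : 1 ≤ k)
    (i : ℕ) (hi : 1 ≤ i) (hilen : i ≤ ((UW p q (k - 1)).2).length) :
    (((UW p q (k - 1)).2.getD (i - 1) 0 : ℕ) : ℤ) =
      (q : ℤ) - ⌊(i : ℝ) * hypBeta p q⌋ + ⌊((i : ℝ) - 1) * hypBeta p q⌋ := by
  obtain ⟨m, rfl⟩ := Nat.exists_eq_add_of_le' hp
  obtain ⟨n, rfl⟩ := Nat.exists_eq_add_of_le' hq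
  obtain ⟨j, rfl⟩ := Nat.exists_eq_add_of_le' hi
  have hpq' : (4 : ℝ) < ((m : ℝ) + 2) * ((n : ℝ) + 2) := by
    have : 4 < (m + 2) * (n + 2) := hpq
    exact_mod_cast this
  have hm : (0 : ℝ) ≤ m := by positivity
  have hn : (0 : ℝ) ≤ n := by positivity
  set S := Real.sqrt (((m : ℝ) + 2) ^ 2 * ((n : ℝ) + 2) ^ 2 -
        4 * (((m : ℝ) + 2) * ((n : ℝ) + 2))) with hS
  set D := ((m : ℝ) + 2) * ((n : ℝ) + 2) with hD
  have hpos : 0 < ((m : ℝ) + 2) ^ 2 * ((n : ℝ) + 2) ^ 2 -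
        4 * (((m : ℝ) + 2) * ((n : ℝ) + 2)) := by
    rw [← mul_pow, ← hD]; nlinarith
  have hS0 : 0 < S := Real.sqrt_pos.mpr hpos
  have hS2 : S ^ 2 = D ^ 2 - 4 * D := by
    rw [hS, Real.sq_sqrt hpos.le, hD]; ring
  have hb : hypBeta (m + 4) (n + 4) = (D + S) / (2 * (m + 2)) := by
    unfold hypBeta
    have e1 : ((m + 4 : ℕ) : ℝ) - 2 = m + 2 := by push_cast; ring
    have e2 : ((n + 4 : ℕ) : ℝ) - 2 = n + 2 := by push_cast; ring
    rw [e1, e2]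
  set e := ((n + 4 : ℕ) : ℝ) - 2 - hypBeta (m + 4) (n + 4) with he
  have hm2 : (0 : ℝ) < m + 2 := by linarith
  have hPe : (m + 2) * e = (D - S) / 2 := by
    rw [he, hb, hD]; push_cast; field_simp; ring
  have hlt1 : (D - S) / 2 < 2 := by nlinarith
  have hgt1 : 1 < (D - S) / 2 := by nlinarith
  have he0 : 0 < e := by
    by_contra hcon
    nlinarith
  have he1 : e < 1 := by
    by_contra hcon
    nlinarith
  have h2 : ((n : ℝ) + 2) * ((m + 2) * e - 1) = e * (1 + ((m + 2) * e - 1)) := by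
    have h3 : ((m + 2) * e) ^ 2 - D * ((m + 2) * e) + D = 0 := by
      rw [hPe]; nlinarith
    rw [hD] at h3
    have : ((m : ℝ) + 2) * (((n : ℝ) + 2) * ((m + 2) * e - 1) - e * (1 + ((m + 2) * e - 1))) = 0 := by
      linear_combination -h3
    rcases mul_eq_zero.mp this with h | h <;> linarith
  have main := (RunW_main m n he0 he1 (t := (m + 2) * e - 1) (by linarith) (by linarith) rfl h2
    (k - 1)).1 0 le_rfl (mul_pos (pow_pos (by linarith) _) he0)
  have := RunW.letter he he0 he1 _ 0 _ 0 0 j (by simp) main (by omega)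
  simpa using this
end

section
/- Let p = 3 and q ≥ 7 be integers. Then for every k ≥ 1 and every index i with 1 ≤ i ≤ length(W_k), the i-th letter of the word W_k equals q − ⌊iβ⌋ + ⌊(i−1)β⌋. (Since each W_k is a prefix of W_{k+1}, this gives the i-th letter of the limit word W = lim_{k→∞} W_k.) -/
/-- For `p = 3`, `q ≥ 7`: `UW3 q k = (U_{k+1}, W_{k+1})`, where `U_1 = (3)`, `W_1 = (4)`,
`U_{k+1} = W_k U_k^{q−5}` and `W_{k+1} = W_k U_k^{q−6}`. -/
def UW3 (q : ℕ) : ℕ → List ℕ × List ℕ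
  | 0 => ([3], [4])
  | k + 1 =>
      ((UW3 q k).2 ++ wpow (UW3 q k).1 (q - 5),
       (UW3 q k).2 ++ wpow (UW3 q k).1 (q - 6))

/-- Drift of a word. -/
noncomputable def drift (g : ℝ) (w : List ℕ) : ℝ := (w.sum : ℝ) - (w.length : ℝ) * (3 + g)

/-- All prefixes have drift in `[a, b]`. -/
def DB (g : ℝ) (w : List ℕ) (a b : ℝ) : Prop :=
  ∀ j, a ≤ drift g (w.take j) ∧ drift g (w.take j) ≤ b

lemma drift_append (g : ℝ) (x y : List ℕ) : drift g (x ++ y) = drift g x + drift g y := by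
  simp only [drift, List.sum_append, List.length_append]; push_cast; ring

lemma DB_append (g : ℝ) (x y : List ℕ) (a b : ℝ) (hx : DB g x a b)
    (hy : DB g y (a - drift g x) (b - drift g x)) : DB g (x ++ y) a b := by
  intro j
  rw [List.take_append]
  rcases le_total j x.length with h | h
  · have : j - x.length = 0 := by omega
    rw [this]; simpa using hx j
  · rw [List.take_of_length_le h, drift_append]
    have := hy (j - x.length)
    constructor <;> linarith [this.1, this.2]

lemma DB_mono {g : ℝ} {x : List ℕ} {a b a' b' : ℝ} (hx : DB g x a b) (h1 : a' ≤ a)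
    (h2 : b ≤ b') : DB g x a' b' := fun j => ⟨h1.trans (hx j).1, (hx j).2.trans h2⟩

lemma wpow_succ (x : List ℕ) (m : ℕ) : wpow x (m + 1) = x ++ wpow x m := by
  simp [wpow, List.replicate_succ]

lemma drift_wpow (g : ℝ) (x : List ℕ) (m : ℕ) : drift g (wpow x m) = m * drift g x := by
  induction m with
  | zero => simp [wpow, drift]
  | succ m ih => rw [wpow_succ, drift_append, ih]; push_cast; ring

lemma DB_wpow (g : ℝ) (x : List ℕ) (m : ℕ) (b : ℝ) (hd : drift g x ≤ 0) (hb : 0 ≤ b)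
    (hx : DB g x (drift g x) b) : DB g (wpow x m) (m * drift g x) b := by
  induction m with
  | zero => intro j; simpa [wpow, drift] using hb
  | succ m ih =>
    rw [wpow_succ]
    have hm : (m : ℝ) * drift g x ≤ 0 := mul_nonpos_of_nonneg_of_nonpos (by positivity) hd
    apply DB_append
    · apply DB_mono hx _ le_rfl
      push_cast; linarith
    · apply DB_mono ih
      · push_cast; linarith
      · linarith

lemma UW_inv (q : ℕ) (hq : 7 ≤ q) (g : ℝ) (h0 : 0 < g) (h1 : g < 1)
    (hg : g ^ 2 - ((q : ℝ) - 4) * g + 1 = 0) (k : ℕ) :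
    drift g (UW3 q k).1 = -g ^ (k + 1) ∧ drift g (UW3 q k).2 = g ^ k - g ^ (k + 1) ∧
    DB g (UW3 q k).1 (-g ^ (k + 1)) (1 - g ^ k) ∧ DB g (UW3 q k).2 0 (1 - g ^ (k + 1)) := by
  induction k with
  | zero =>
    refine ⟨?_, ?_, ?_, ?_⟩
    · simp [UW3, drift]
    · simp [UW3, drift]; ring
    · rintro (_ | j) <;> simp [UW3, drift, h0.le]
    · rintro (_ | j)
      · simp [UW3, drift, h1.le]
      · simp [UW3, drift]; constructor <;> linarith
  | succ k ih =>
    obtain ⟨hU, hW, bU, bW⟩ := ih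
    have pk : 0 < g ^ k := by positivity
    have hk1 : g ^ k ≤ 1 := pow_le_one₀ h0.le h1.le
    have e1 : g ^ (k + 1) = g ^ k * g := pow_succ _ _
    have e2 : g ^ (k + 1 + 1) = ((q : ℝ) - 4) * g ^ (k + 1) - g ^ k := by
      have : g ^ (k + 1 + 1) = g ^ k * g ^ 2 := by ring
      rw [this, e1, show g ^ 2 = ((q : ℝ) - 4) * g - 1 by linarith]; ring
    have p1 : 0 < g ^ (k + 1) := by positivity
    have p2 : 0 < g ^ (k + 1 + 1) := by positivity
    have l1 : g ^ (k + 1) ≤ g ^ k := by rw [e1]; nlinarith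
    have l2 : g ^ (k + 1 + 1) ≤ g ^ (k + 1) := by rw [pow_succ _ (k + 1)]; nlinarith
    have c5 : ((q - 5 : ℕ) : ℝ) = (q : ℝ) - 5 := by
      rw [Nat.cast_sub (by omega)]; norm_num
    have c6 : ((q - 6 : ℕ) : ℝ) = (q : ℝ) - 6 := by
      rw [Nat.cast_sub (by omega)]; norm_num
    have B : ∀ m, DB g (wpow (UW3 q k).1 m) (m * -g ^ (k + 1)) (1 - g ^ k) := by
      intro m
      have := DB_wpow g (UW3 q k).1 m (1 - g ^ k) (by rw [hU]; linarith) (by linarith)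
        (by rw [hU]; exact bU)
      rwa [hU] at this
    refine ⟨?_, ?_, ?_, ?_⟩
    · simp only [UW3]
      rw [drift_append, drift_wpow, hU, hW, c5, e2]; ring
    · simp only [UW3]
      rw [drift_append, drift_wpow, hU, hW, c6, e2]; ring
    · simp only [UW3]
      apply DB_append
      · exact DB_mono bW (by linarith) (by linarith)
      · apply DB_mono (B (q - 5))
        · rw [c5, hW]; linarith
        · rw [hW]; linarith
    · simp only [UW3]
      apply DB_append
      · exact DB_mono bW (by linarith) (by linarith)
      · apply DB_mono (B (q - 6))
        · rw [c6, hW]; linarith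
        · rw [hW]; linarith

lemma beta_props (q : ℕ) (hq : 7 ≤ q) : ∃ g : ℝ, 0 < g ∧ g < 1 ∧
    g ^ 2 - ((q : ℝ) - 4) * g + 1 = 0 ∧ hypBeta 3 q = (q : ℝ) - 3 - g := by
  have hq' : (7 : ℝ) ≤ q := by exact_mod_cast hq
  obtain ⟨s, hs⟩ : ∃ s, s = Real.sqrt (((q : ℝ) - 2) ^ 2 - 4 * ((q : ℝ) - 2)) := ⟨_, rfl⟩
  have hs0 : 0 ≤ s := hs ▸ Real.sqrt_nonneg _
  have hs2 : s ^ 2 = ((q : ℝ) - 2) ^ 2 - 4 * ((q : ℝ) - 2) := by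
    rw [hs]; exact Real.sq_sqrt (by nlinarith)
  refine ⟨((q : ℝ) - 4 - s) / 2, ?_, ?_, ?_, ?_⟩
  · nlinarith
  · nlinarith
  · nlinarith
  · have e : ((3 : ℕ) : ℝ) - 2 = 1 := by norm_num
    unfold hypBeta
    rw [e]
    simp only [one_mul, one_pow, mul_one]
    rw [← hs]; ring

lemma floor_eq (q k : ℕ) (hq : 7 ≤ q) (i : ℕ) (hi : i ≤ ((UW3 q k).2).length) :
    ⌊(i : ℝ) * hypBeta 3 q⌋ = (i : ℤ) * q - ((((UW3 q k).2).take i).sum : ℕ) := by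
  obtain ⟨g, h0, h1, hg, hb⟩ := beta_props q hq
  have := (UW_inv q hq g h0 h1 hg k).2.2.2 i
  have p : 0 < g ^ (k + 1) := by positivity
  simp only [drift, List.length_take, min_eq_left hi] at this
  rw [Int.floor_eq_iff, hb]
  generalize (List.take i (UW3 q k).2).sum = S at this ⊢
  push_cast at this ⊢
  constructor <;> linarith [this.1, this.2]

/-- For `p = 3`, `q ≥ 7`, the `i`-th letter of `W_k` equals `q − ⌊iβ⌋ + ⌊(i−1)β⌋`. -/
theorem W_letter_formula_p3 (q : ℕ) (hq : 7 ≤ q) (k : ℕ) (hk : 1 ≤ k)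
    (i : ℕ) (hi : 1 ≤ i) (hilen : i ≤ ((UW3 q (k - 1)).2).length) :
    (((UW3 q (k - 1)).2.getD (i - 1) 0 : ℕ) : ℤ) =
      (q : ℤ) - ⌊(i : ℝ) * hypBeta 3 q⌋ + ⌊((i : ℝ) - 1) * hypBeta 3 q⌋ := by
  obtain ⟨j, rfl⟩ : ∃ j, i = j + 1 := ⟨i - 1, by omega⟩
  have a := floor_eq q (k - 1) hq (j + 1) hilen
  have b := floor_eq q (k - 1) hq j (by omega)
  have e : (((j + 1 : ℕ) : ℝ) - 1) = j := by push_cast; ring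
  rw [e, a, b, Nat.add_sub_cancel, List.sum_take_succ _ _ (by omega),
    List.getD_eq_getElem _ _ (by omega)]
  push_cast; ring
end

section
/- Let q = 3 and p ≥ 7 be integers. Then for every k ≥ 1 and every index i with 1 ≤ i ≤ length(W_k), the i-th letter of the word W_k equals q − ⌊iβ⌋ + ⌊(i−1)β⌋ = 3 − ⌊iβ⌋ + ⌊(i−1)β⌋. (Since each W_k is a prefix of W_{k+1}, this gives the i-th letter of the limit word W = lim_{k→∞} W_k.) -/
/-- For `q = 3`, `p ≥ 7`: `UWq3 p k = (U_{k+1}, W_{k+1})`, where `U_1 = (2)`, `W_1 = (3,2)`,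
`U_{k+1} = W_k U_k^{p−5}` and `W_{k+1} = W_k U_k^{p−6}`. -/
def UWq3 (p : ℕ) : ℕ → List ℕ × List ℕ
  | 0 => ([2], [3, 2])
  | k + 1 =>
      ((UWq3 p k).2 ++ wpow (UWq3 p k).1 (p - 5),
       (UWq3 p k).2 ++ wpow (UWq3 p k).1 (p - 6))

namespace WLF

def T (L : List ℕ) : ℤ := (L.map (fun a : ℕ => (3 : ℤ) - (a : ℤ))).sum

noncomputable def d (b : ℝ) (L : List ℕ) : ℝ := (L.length : ℝ) * b - (T L : ℝ)

def Good (b : ℝ) (L : List ℕ) (lo hi : ℝ) : Prop :=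
  ∀ i, lo ≤ d b (L.take i) ∧ d b (L.take i) ≤ hi

lemma T_append (A B : List ℕ) : T (A ++ B) = T A + T B := by simp [T]

lemma d_append (b : ℝ) (A B : List ℕ) : d b (A ++ B) = d b A + d b B := by
  simp only [d, T_append, List.length_append]; push_cast; ring

lemma d_nil (b : ℝ) : d b [] = 0 := by simp [d, T]

lemma wpow_zero (X : List ℕ) : wpow X 0 = [] := by simp [wpow]

lemma wpow_succ (X : List ℕ) (a : ℕ) : wpow X (a + 1) = X ++ wpow X a := by
  simp [wpow, List.replicate_succ]

lemma d_wpow (b : ℝ) (X : List ℕ) (a : ℕ) : d b (wpow X a) = a * d b X := by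
  induction a with
  | zero => simp [wpow_zero, d_nil]
  | succ a ih => rw [wpow_succ, d_append, ih]; push_cast; ring

lemma Good.append {b : ℝ} {A B : List ℕ} {lo hi lo' hi' : ℝ} (hA : Good b A lo hi)
    (hB : Good b B lo' hi') (h1 : lo ≤ d b A + lo') (h2 : d b A + hi' ≤ hi) :
    Good b (A ++ B) lo hi := by
  intro i
  rcases le_total i A.length with h | h
  · rw [List.take_append_of_le_length h]; exact hA i
  · rw [List.take_append, List.take_of_length_le h, d_append]
    have := hB (i - A.length)
    constructor <;> linarith [this.1, this.2]

lemma Good.mono {b : ℝ} {A : List ℕ} {lo hi lo' hi' : ℝ} (hA : Good b A lo hi)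
    (h1 : lo' ≤ lo) (h2 : hi ≤ hi') : Good b A lo' hi' :=
  fun i => ⟨h1.trans (hA i).1, (hA i).2.trans h2⟩

lemma Good.wpow {b : ℝ} {X : List ℕ} {c hi : ℝ} (hX : Good b X (-c) hi) (hc : 0 ≤ c)
    (hd : d b X = -c) (hhi : 0 ≤ hi) (a : ℕ) : Good b (wpow X a) (-(a * c)) hi := by
  induction a with
  | zero => intro i; simp [wpow_zero, d_nil, hhi]
  | succ a ih =>
    rw [wpow_succ]
    have : 0 ≤ (a : ℝ) * c := by positivity
    refine Good.append (hX.mono ?_ le_rfl) ih ?_ ?_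
    · push_cast; linarith
    · rw [hd]; push_cast; linarith
    · rw [hd]; linarith

lemma main (p : ℕ) (hp : 7 ≤ p) (b : ℝ) (h1 : 1 / 2 < b) (h2 : b < 1)
    (hb : ((p : ℝ) - 2) * (b * (1 - b)) = 1) (k : ℕ) :
    ∃ c c' : ℝ, 0 < c ∧ c ≤ c' ∧ c' ≤ 1 ∧ b * c = (1 - b) * c' ∧
      d b (UWq3 p k).1 = -c ∧ d b (UWq3 p k).2 = c' - c ∧
      Good b (UWq3 p k).1 (-c) (1 - c') ∧ Good b (UWq3 p k).2 0 (1 - c) := by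
  induction k with
  | zero =>
    refine ⟨1 - b, b, by linarith, by linarith, by linarith, by ring, ?_, ?_, ?_, ?_⟩
    · simp [UWq3, d, T]
    · simp [UWq3, d, T]; ring
    · intro i
      rcases i with _ | i
      · simp [d, T]; linarith
      · simp [UWq3, d, T]; linarith
    · intro i
      rcases i with _ | _ | i
      · simp [d, T]; linarith
      · simp [UWq3, d, T]; linarith
      · simp [UWq3, d, T]; constructor <;> linarith
  | succ k ih =>
    obtain ⟨c, c', hc, hcc, hc1, hr, hU, hW, gU, gW⟩ := ih
    have e5 : ((p - 5 : ℕ) : ℝ) = p - 5 := by rw [Nat.cast_sub (by omega)]; norm_num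
    have e6 : ((p - 6 : ℕ) : ℝ) = p - 6 := by rw [Nat.cast_sub (by omega)]; norm_num
    obtain ⟨e, he⟩ : ∃ e : ℝ, e = ((p : ℝ) - 4) * c - c' := ⟨_, rfl⟩
    have hre : b * e = (1 - b) * c := by
      have h0 : (1 - b) ≠ 0 := by linarith
      apply mul_left_cancel₀ h0
      rw [he]
      linear_combination c * hb + b * hr
    have he0 : 0 < e := by
      have : 0 < b * e := by rw [hre]; apply mul_pos <;> linarith
      exact pos_of_mul_pos_right this (by linarith)
    have hec : e ≤ c := by nlinarith
    have hdU : d b (UWq3 p (k+1)).1 = -e := by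
      simp only [UWq3]; rw [d_append, d_wpow, hU, hW, e5, he]; ring
    have hdW : d b (UWq3 p (k+1)).2 = c - e := by
      simp only [UWq3]; rw [d_append, d_wpow, hU, hW, e6, he]; ring
    refine ⟨e, c, he0, hec, by linarith, hre, hdU, hdW, ?_, ?_⟩
    · simp only [UWq3]
      refine Good.append (gW.mono (by linarith) le_rfl)
        (gU.wpow hc.le hU (by linarith) _) ?_ ?_
      · rw [hW, e5, he]; linarith
      · rw [hW]; linarith
    · simp only [UWq3]
      refine Good.append (gW.mono le_rfl (by linarith))
        (gU.wpow hc.le hU (by linarith) _) ?_ ?_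
      · rw [hW, e6]; linarith
      · rw [hW]; linarith

lemma beta (p : ℕ) (hp : 7 ≤ p) : 1 / 2 < hypBeta p 3 ∧ hypBeta p 3 < 1 ∧
    ((p : ℝ) - 2) * (hypBeta p 3 * (1 - hypBeta p 3)) = 1 := by
  have hp' : (7 : ℝ) ≤ p := by exact_mod_cast hp
  obtain ⟨n, hn⟩ : ∃ n : ℝ, n = (p : ℝ) - 2 := ⟨_, rfl⟩
  have hn5 : 5 ≤ n := by linarith
  have hbd : hypBeta p 3 = (n + Real.sqrt (n ^ 2 - 4 * n)) / (2 * n) := by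
    unfold hypBeta; rw [← hn]; norm_num
  have hpos : 0 < n ^ 2 - 4 * n := by nlinarith
  have hs := Real.sq_sqrt hpos.le
  have hs0 := Real.sqrt_pos.2 hpos
  rw [hbd, ← hn]
  generalize Real.sqrt (n ^ 2 - 4 * n) = s at *
  have hsn : s < n := by nlinarith
  refine ⟨?_, ?_, ?_⟩
  · rw [div_lt_div_iff₀ (by norm_num) (by linarith)]; linarith
  · rw [div_lt_one (by linarith)]; linarith
  · have : n ≠ 0 := by linarith
    field_simp
    linear_combination -hs

lemma floor_eq {b c : ℝ} {L : List ℕ} (hc : 0 < c) (h : Good b L 0 (1 - c)) (i : ℕ)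
    (hi : i ≤ L.length) : ⌊(i : ℝ) * b⌋ = T (L.take i) := by
  have := h i
  simp only [d, List.length_take, min_eq_left hi] at this
  rw [Int.floor_eq_iff]
  constructor <;> linarith [this.1, this.2]

end WLF

/-- For `q = 3`, `p ≥ 7`, the `i`-th letter of `W_k` equals
`q − ⌊iβ⌋ + ⌊(i−1)β⌋ = 3 − ⌊iβ⌋ + ⌊(i−1)β⌋`. -/
theorem W_letter_formula_q3 (p : ℕ) (hp : 7 ≤ p) (k : ℕ) (hk : 1 ≤ k)
    (i : ℕ) (hi : 1 ≤ i) (hilen : i ≤ ((UWq3 p (k - 1)).2).length) :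
    (((UWq3 p (k - 1)).2.getD (i - 1) 0 : ℕ) : ℤ) =
      (3 : ℤ) - ⌊(i : ℝ) * hypBeta p 3⌋ + ⌊((i : ℝ) - 1) * hypBeta p 3⌋ := by
  obtain ⟨h1, h2, hb⟩ := WLF.beta p hp
  obtain ⟨c, c', hc, -, -, -, -, -, -, g⟩ := WLF.main p hp _ h1 h2 hb (k - 1)
  obtain ⟨j, rfl⟩ : ∃ j, i = j + 1 := ⟨i - 1, by omega⟩
  have e : (((j + 1 : ℕ) : ℝ) - 1) = (j : ℝ) := by push_cast; ring
  rw [e, WLF.floor_eq hc g _ hilen, WLF.floor_eq hc g j (by omega)]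
  rw [List.take_succ_eq_append_getElem (by omega), WLF.T_append]
  simp [WLF.T, List.getD_eq_getElem?_getD, List.getElem?_eq_getElem (show j < ((UWq3 p (k - 1)).2).length by omega)]
  ring
end

section
/- Let p ≥ 4 and q ≥ 4 be integers with (p−2)(q−2) > 4, and let u_k and w_k denote the lengths of the words U_k and W_k respectively. Then for every k ≥ 1: u_k = γ_k + γ_{k−1} and w_k = γ_k − (p−3)γ_{k−1}. -/
/-- `α = (((p−2)(q−2)−2) + √(((p−2)(q−2)−2)² − 4))/2`. -/
noncomputable def hypAlpha (p q : ℕ) : ℝ :=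
  ((((p : ℝ) - 2) * ((q : ℝ) - 2) - 2) +
      Real.sqrt ((((p : ℝ) - 2) * ((q : ℝ) - 2) - 2) ^ 2 - 4)) / 2

/-- `γ_k = (α^k − α^{−k})/(α − α^{−1})`. -/
noncomputable def hypGamma (p q : ℕ) (k : ℕ) : ℝ :=
  ((hypAlpha p q) ^ k - (hypAlpha p q)⁻¹ ^ k) / (hypAlpha p q - (hypAlpha p q)⁻¹)

theorem wpow_length (X : List ℕ) (a : ℕ) : (wpow X a).length = a * X.length := by
  simp [wpow]

theorem alpha_facts (p q : ℕ) (ht : 4 < ((p : ℝ) - 2) * ((q : ℝ) - 2)) :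
    1 < hypAlpha p q ∧
    hypAlpha p q + (hypAlpha p q)⁻¹ = ((p : ℝ) - 2) * ((q : ℝ) - 2) - 2 := by
  unfold hypAlpha
  generalize ((p : ℝ) - 2) * ((q : ℝ) - 2) = m at *
  have h0 : 0 ≤ (m - 2) ^ 2 - 4 := by nlinarith
  have hs := Real.sq_sqrt h0
  have hn := Real.sqrt_nonneg ((m - 2) ^ 2 - 4)
  generalize Real.sqrt ((m - 2) ^ 2 - 4) = s at *
  have h1 : 1 < (m - 2 + s) / 2 := by linarith
  refine ⟨h1, ?_⟩
  have h2 : ((m - 2 + s) / 2)⁻¹ = (m - 2 - s) / 2 := by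
    apply inv_eq_of_mul_eq_one_right
    nlinarith
  rw [h2]; ring

theorem gamma_facts (p q : ℕ) (ht : 4 < ((p : ℝ) - 2) * ((q : ℝ) - 2)) :
    hypGamma p q 0 = 0 ∧ hypGamma p q 1 = 1 ∧ ∀ k, hypGamma p q (k + 2) =
      (((p : ℝ) - 2) * ((q : ℝ) - 2) - 2) * hypGamma p q (k + 1) - hypGamma p q k := by
  obtain ⟨h1, h2⟩ := alpha_facts p q ht
  unfold hypGamma
  rw [← h2]
  generalize hypAlpha p q = a at *
  have h3 : a * a⁻¹ = 1 := mul_inv_cancel₀ (by linarith)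
  have h4 : a⁻¹ < 1 := inv_lt_one_of_one_lt₀ h1
  generalize a⁻¹ = b at *
  have h5 : a - b ≠ 0 := by linarith
  refine ⟨by simp, by simp [div_self h5], fun k => ?_⟩
  rw [← mul_div_assoc, ← sub_div]
  congr 1
  linear_combination (a ^ k - b ^ k) * (-h3)

/-- For `p ≥ 4`, `q ≥ 4` with `(p−2)(q−2) > 4` and every `k ≥ 1`:
`u_k = γ_k + γ_{k−1}` and `w_k = γ_k − (p−3)γ_{k−1}`. -/
theorem word_lengths (p q : ℕ) (hp : 4 ≤ p) (hq : 4 ≤ q)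
    (hpq : 4 < (p - 2) * (q - 2)) (k : ℕ) (hk : 1 ≤ k) :
    ((((UW p q (k - 1)).1).length : ℝ) = hypGamma p q k + hypGamma p q (k - 1)) ∧
    ((((UW p q (k - 1)).2).length : ℝ) =
      hypGamma p q k - ((p : ℝ) - 3) * hypGamma p q (k - 1)) := by
  obtain ⟨k, rfl⟩ : ∃ n, k = n + 1 := ⟨k - 1, by omega⟩
  have ht : 4 < ((p : ℝ) - 2) * ((q : ℝ) - 2) := by
    have : ((4 : ℕ) : ℝ) < (((p - 2) * (q - 2) : ℕ) : ℝ) := by exact_mod_cast hpq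
    rw [Nat.cast_mul, Nat.cast_sub (by omega), Nat.cast_sub (by omega)] at this
    exact_mod_cast this
  obtain ⟨g0, g1, g2⟩ := gamma_facts p q ht
  clear hk
  simp only [Nat.add_sub_cancel]
  induction k with
  | zero => simp [UW, g0, g1]
  | succ k ih =>
    obtain ⟨ih1, ih2⟩ := ih
    have e1 : ((p - 4 : ℕ) : ℝ) = p - 4 := by rw [Nat.cast_sub hp]; norm_num
    have e2 : ((p - 3 : ℕ) : ℝ) = p - 3 := by rw [Nat.cast_sub (by omega)]; norm_num
    have e3 : ((q - 4 : ℕ) : ℝ) = q - 4 := by rw [Nat.cast_sub hq]; norm_num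
    have e4 : ((q - 3 : ℕ) : ℝ) = q - 3 := by rw [Nat.cast_sub (by omega)]; norm_num
    simp only [UW, List.length_append, wpow_length, Nat.cast_add, Nat.cast_mul, e1, e2, e3, e4,
      ih1, ih2, g2]
    constructor <;> ring
end

section
/- Let p = 3 and q ≥ 7 be integers, and let u_k and w_k denote the lengths of the words U_k and W_k respectively. Then for every k ≥ 1: u_k = γ_k and w_k = γ_k − γ_{k−1}. -/
lemma hypAlpha_facts (q : ℕ) (hq : 7 ≤ q) :
    1 < hypAlpha 3 q ∧ hypAlpha 3 q + (hypAlpha 3 q)⁻¹ = (q : ℝ) - 4 := by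
  have hq' : (7 : ℝ) ≤ q := by exact_mod_cast hq
  have e : hypAlpha 3 q = (((q : ℝ) - 4) + Real.sqrt (((q : ℝ) - 4) ^ 2 - 4)) / 2 := by
    unfold hypAlpha
    have h1 : (((3 : ℕ) : ℝ) - 2) * ((q : ℝ) - 2) - 2 = (q : ℝ) - 4 := by push_cast; ring
    rw [h1]
  have h0 : 0 ≤ ((q : ℝ) - 4) ^ 2 - 4 := by nlinarith
  have hs := Real.sq_sqrt h0
  have hn := Real.sqrt_nonneg (((q : ℝ) - 4) ^ 2 - 4)
  have h1 : 1 < hypAlpha 3 q := by rw [e]; linarith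
  refine ⟨h1, ?_⟩
  have h2 : hypAlpha 3 q ^ 2 + 1 = ((q : ℝ) - 4) * hypAlpha 3 q := by
    rw [e]; nlinarith
  have h3 : hypAlpha 3 q ≠ 0 := by linarith
  field_simp
  linarith

lemma hypGamma_rec (q : ℕ) (hq : 7 ≤ q) (k : ℕ) :
    hypGamma 3 q (k + 2) = ((q : ℝ) - 4) * hypGamma 3 q (k + 1) - hypGamma 3 q k := by
  obtain ⟨h1, h2⟩ := hypAlpha_facts q hq
  have h3 : hypAlpha 3 q * (hypAlpha 3 q)⁻¹ = 1 := mul_inv_cancel₀ (by linarith)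
  rw [← h2]
  unfold hypGamma
  generalize hypAlpha 3 q = a at *
  generalize a⁻¹ = b at *
  rw [← mul_div_assoc, ← sub_div]
  congr 1
  linear_combination (b ^ k - a ^ k) * h3

lemma word_lengths_aux (q : ℕ) (hq : 7 ≤ q) (k : ℕ) :
    ((((UW3 q k).1).length : ℝ) = hypGamma 3 q (k + 1)) ∧
    ((((UW3 q k).2).length : ℝ) = hypGamma 3 q (k + 1) - hypGamma 3 q k) := by
  induction k with
  | zero =>
    obtain ⟨h1, h2⟩ := hypAlpha_facts q hq
    have h4 : (hypAlpha 3 q)⁻¹ < 1 := inv_lt_one_of_one_lt₀ h1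
    have h3 : hypAlpha 3 q - (hypAlpha 3 q)⁻¹ ≠ 0 := by
      intro h; linarith
    simp [UW3, hypGamma, div_self h3]
  | succ k ih =>
    obtain ⟨i1, i2⟩ := ih
    have hr := hypGamma_rec q hq k
    have c5 : ((q - 5 : ℕ) : ℝ) = q - 5 := by rw [Nat.cast_sub (by omega)]; norm_num
    have c6 : ((q - 6 : ℕ) : ℝ) = q - 6 := by rw [Nat.cast_sub (by omega)]; norm_num
    simp only [UW3, wpow, List.length_append, List.length_flatten, List.map_replicate,
      List.sum_replicate, smul_eq_mul, Nat.cast_add, Nat.cast_mul, i1, i2, c5, c6]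
    rw [show k + 1 + 1 = k + 2 from rfl, hr]
    constructor <;> ring

/-- For `p = 3`, `q ≥ 7` and every `k ≥ 1`: `u_k = γ_k` and `w_k = γ_k − γ_{k−1}`. -/
theorem word_lengths_p3 (q : ℕ) (hq : 7 ≤ q) (k : ℕ) (hk : 1 ≤ k) :
    ((((UW3 q (k - 1)).1).length : ℝ) = hypGamma 3 q k) ∧
    ((((UW3 q (k - 1)).2).length : ℝ) = hypGamma 3 q k - hypGamma 3 q (k - 1)) := by
  obtain ⟨n, rfl⟩ : ∃ n, k = n + 1 := ⟨k - 1, by omega⟩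
  exact word_lengths_aux q hq n
end

section
/- For every k ≥ 1, the quantities P_k and n_k satisfy the identity P_k − (p−2)·n_k = 2·( p/(α−1) + p·α^{−k}/(α^{−1} − 1) + 1 + 1/β − n_k/β ). -/
/-- `n_k = 1 + (p(q−2)/(α − α^{−1}))·((α^k − 1)/(α − 1) − (α^{−k} − 1)/(α^{−1} − 1))`. -/
noncomputable def hypN (p q : ℕ) (k : ℕ) : ℝ :=
  1 + ((p : ℝ) * ((q : ℝ) - 2) / (hypAlpha p q - (hypAlpha p q)⁻¹)) *
    (((hypAlpha p q) ^ k - 1) / (hypAlpha p q - 1) -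
      ((hypAlpha p q)⁻¹ ^ k - 1) / ((hypAlpha p q)⁻¹ - 1))

/-- `P_k = (p/(α − α^{−1}))·(α^k − α^{−k} + α^{k−1} − α^{−(k−1)})`. -/
noncomputable def hypP (p q : ℕ) (k : ℕ) : ℝ :=
  ((p : ℝ) / (hypAlpha p q - (hypAlpha p q)⁻¹)) *
    ((hypAlpha p q) ^ k - (hypAlpha p q)⁻¹ ^ k +
      (hypAlpha p q) ^ (k - 1) - (hypAlpha p q)⁻¹ ^ (k - 1))

/-- For every `k ≥ 1`:
`P_k − (p−2)·n_k = 2·(p/(α−1) + p·α^{−k}/(α^{−1}−1) + 1 + 1/β − n_k/β)`. -/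
theorem Pk_nk_identity (p q : ℕ) (hp : 3 ≤ p) (hq : 3 ≤ q)
    (hpq : 4 < (p - 2) * (q - 2)) (k : ℕ) (hk : 1 ≤ k) :
    hypP p q k - ((p : ℝ) - 2) * hypN p q k =
      2 * ((p : ℝ) / (hypAlpha p q - 1) +
        (p : ℝ) * (hypAlpha p q)⁻¹ ^ k / ((hypAlpha p q)⁻¹ - 1) +
        1 + 1 / hypBeta p q - hypN p q k / hypBeta p q) := by
  have hb : (1 : ℝ) ≤ (p : ℝ) - 2 := by
    have : (3 : ℝ) ≤ p := by exact_mod_cast hp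
    linarith
  have hs : 4 < ((p : ℝ) - 2) * ((q : ℝ) - 2) := by
    have h : ((4 : ℕ) : ℝ) < (((p - 2) * (q - 2) : ℕ) : ℝ) := by exact_mod_cast hpq
    rw [Nat.cast_mul, Nat.cast_sub (by omega), Nat.cast_sub (by omega)] at h
    exact_mod_cast h
  have hβ : hypBeta p q = (hypAlpha p q + 1) / ((p : ℝ) - 2) := by
    unfold hypBeta hypAlpha
    have : ((p : ℝ) - 2) ^ 2 * ((q : ℝ) - 2) ^ 2 - 4 * (((p : ℝ) - 2) * ((q : ℝ) - 2))
        = (((p : ℝ) - 2) * ((q : ℝ) - 2) - 2) ^ 2 - 4 := by ring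
    rw [this]
    have : (p : ℝ) - 2 ≠ 0 := by linarith
    field_simp
    ring
  have ha : 1 < hypAlpha p q := by
    unfold hypAlpha
    have := Real.sqrt_nonneg ((((p : ℝ) - 2) * ((q : ℝ) - 2) - 2) ^ 2 - 4)
    linarith
  have hq2 : (hypAlpha p q + 1) ^ 2 = ((p : ℝ) - 2) * ((q : ℝ) - 2) * hypAlpha p q := by
    unfold hypAlpha
    have := Real.sq_sqrt (show 0 ≤ (((p : ℝ) - 2) * ((q : ℝ) - 2) - 2) ^ 2 - 4 by nlinarith)
    linear_combination this / 4
  unfold hypP hypN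
  rw [hβ]
  generalize hypAlpha p q = a at *
  obtain ⟨m, rfl⟩ : ∃ m, k = m + 1 := ⟨k - 1, by omega⟩
  have hc : (q : ℝ) - 2 = (a + 1) ^ 2 / (a * ((p : ℝ) - 2)) := by
    have : (p : ℝ) - 2 ≠ 0 := by linarith
    have : a ≠ 0 := by linarith
    field_simp
    linarith
  rw [hc]
  obtain ⟨b, hbb⟩ : ∃ b : ℝ, b = (p : ℝ) - 2 := ⟨_, rfl⟩
  have hp' : (p : ℝ) = b + 2 := by linarith
  rw [← hbb] at *
  rw [hp']
  have h0 : a ≠ 0 := by linarith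
  have h1 : a - 1 ≠ 0 := by linarith
  have h2 : a + 1 ≠ 0 := by linarith
  have h3 : b ≠ 0 := by linarith
  have e1 : a - a⁻¹ = (a - 1) * (a + 1) / a := by field_simp; ring
  have e2 : a⁻¹ - 1 = -(a - 1) / a := by field_simp; ring
  rw [e1, e2]
  simp only [Nat.add_sub_cancel, inv_pow, pow_succ]
  have hx : a ^ m ≠ 0 := pow_ne_zero _ h0
  generalize a ^ m = x at *
  field_simp
  ring
end

section
/- Let n ≥ 2 and k ≥ 1 be integers, and set Δ = α + 1 + (n−2)(α−1)(α−α^{−1})/(p(q−2)). Then n_k < n ≤ n_{k+1} if and only if k = ⌊ log_α( (Δ + √(Δ² − 4α))/2 ) ⌋. -/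
lemma aux_alpha (p q : ℕ) (hp : 3 ≤ p) (hq : 3 ≤ q) (hpq : 4 < (p - 2) * (q - 2)) :
    1 < hypAlpha p q ∧ hypAlpha p q + (hypAlpha p q)⁻¹ = ((((p:ℤ)-2)*((q:ℤ)-2)-2 : ℤ) : ℝ) := by
  obtain ⟨r, rfl⟩ := Nat.exists_eq_add_of_le hp
  obtain ⟨t, rfl⟩ := Nat.exists_eq_add_of_le hq
  have e1 : 3 + r - 2 = r + 1 := by omega
  have e2 : 3 + t - 2 = t + 1 := by omega
  rw [e1, e2] at hpq
  have h : (4:ℝ) < (r+1)*(t+1) := by exact_mod_cast hpq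
  have hM : (2:ℝ) < (((3+r:ℕ):ℝ) - 2) * (((3+t:ℕ):ℝ)-2) - 2 := by
    push_cast; nlinarith
  simp only [Int.cast_sub, Int.cast_mul, Int.cast_natCast, Int.cast_ofNat]
  unfold hypAlpha
  generalize (((3+r:ℕ):ℝ) - 2) * (((3+t:ℕ):ℝ)-2) - 2 = M at hM ⊢
  have hs0 := Real.sqrt_nonneg (M^2-4)
  have hs := Real.sq_sqrt (show 0 ≤ M^2-4 by nlinarith)
  generalize Real.sqrt (M^2-4) = s at *
  refine ⟨by linarith, ?_⟩
  have : ((M+s)/2)⁻¹ = (M-s)/2 := by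
    apply inv_eq_of_mul_eq_one_right
    nlinarith
  rw [this]; ring

lemma aux_int (a : ℝ) (ha : 1 < a) (M : ℤ) (hM : a + a⁻¹ = M) (k : ℕ) :
    (∃ z : ℤ, a^k - a⁻¹^k = z * (a - a⁻¹)) ∧ ∃ z : ℤ, a^(k+1) - a⁻¹^(k+1) = z * (a - a⁻¹) := by
  induction k with
  | zero => exact ⟨⟨0, by simp⟩, ⟨1, by simp⟩⟩
  | succ k ih =>
    obtain ⟨⟨z, hz⟩, ⟨w, hw⟩⟩ := ih
    refine ⟨⟨w, hw⟩, ⟨M * w - z, ?_⟩⟩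
    push_cast
    have h1 : a * a⁻¹ = 1 := mul_inv_cancel₀ (by linarith)
    rw [← hM]
    generalize a⁻¹ = b at *
    have : a^(k+1+1) - b^(k+1+1) = (a+b)*(a^(k+1) - b^(k+1)) - (a*b)*(a^k-b^k) := by ring
    rw [this, hw, hz, h1]; ring

lemma aux_closed (p q : ℕ) (ha : 1 < hypAlpha p q) (k : ℕ) :
    hypN p q k = 1 + (p : ℝ) * ((q : ℝ) - 2) /
      ((hypAlpha p q - 1) * (hypAlpha p q - (hypAlpha p q)⁻¹)) *
      ((hypAlpha p q)^k + hypAlpha p q * (hypAlpha p q)⁻¹^k - (hypAlpha p q + 1)) := by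
  unfold hypN
  generalize hypAlpha p q = a at *
  have h1 : a * a⁻¹ = 1 := mul_inv_cancel₀ (by linarith)
  have hb : a⁻¹ < 1 := inv_lt_one_of_one_lt₀ ha
  have h2 : a - 1 ≠ 0 := by linarith
  have h3 : a⁻¹ - 1 ≠ 0 := by linarith
  have h4 : a - a⁻¹ ≠ 0 := by linarith
  have h5 : (a⁻¹ ^ k - 1) / (a⁻¹ - 1) = (a - a * a⁻¹^k) / (a-1) := by
    rw [div_eq_div_iff h3 h2]
    generalize a⁻¹ ^ k = y
    linear_combination (y-1) * h1
  rw [h5]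
  generalize a⁻¹ ^ k = y
  generalize a⁻¹ = b at *
  field_simp
  ring

lemma aux_isint (p q : ℕ) (ha : 1 < hypAlpha p q) (M : ℤ)
    (hM : hypAlpha p q + (hypAlpha p q)⁻¹ = M) (k : ℕ) : ∃ z : ℤ, hypN p q (k+1) = z := by
  induction k with
  | zero => 
    refine ⟨1, ?_⟩
    rw [aux_closed p q ha]
    have h1 : hypAlpha p q * (hypAlpha p q)⁻¹ = 1 := mul_inv_cancel₀ (by linarith)
    simp [h1]
  | succ k ih =>
    obtain ⟨z, hz⟩ := ih
    obtain ⟨w, hw⟩ := (aux_int _ ha M hM k).2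
    refine ⟨z + p * (q-2) * w, ?_⟩
    push_cast
    rw [← hz, aux_closed p q ha, aux_closed p q ha]
    generalize hypAlpha p q = a at *
    have h1 : a * a⁻¹ = 1 := mul_inv_cancel₀ (by linarith)
    have hb : a⁻¹ < 1 := inv_lt_one_of_one_lt₀ ha
    have h2 : a - 1 ≠ 0 := by linarith
    have h4 : a - a⁻¹ ≠ 0 := by linarith
    generalize a⁻¹ = b at *
    have : (a^(k+1+1) + a * b^(k+1+1) - (a+1)) = (a^(k+1) + a * b^(k+1) - (a+1))
        + (a-1)*(w * (a-b)) := by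
      rw [← hw]
      linear_combination (b^(k+1)) * h1
    rw [this]
    generalize (a^(k+1) + a * b^(k+1) - (a+1)) = y
    field_simp
    ring

lemma aux_root (a D : ℝ) (ha : 1 < a) (hD : a + 1 ≤ D) (k : ℕ) (hk : 1 ≤ k) :
    a^k ≤ (D + Real.sqrt (D^2 - 4*a))/2 ↔ a^k + a * a⁻¹^k ≤ D := by
  have hs0 := Real.sqrt_nonneg (D^2-4*a)
  have hs := Real.sq_sqrt (show 0 ≤ D^2-4*a by nlinarith [sq_nonneg (a-1)])
  have hs1 : a - 1 ≤ Real.sqrt (D^2-4*a) := Real.le_sqrt_of_sq_le (by nlinarith)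
  generalize Real.sqrt (D^2-4*a) = s at *
  have hy : a ≤ a^k := le_self_pow₀ ha.le (by omega)
  rw [inv_pow]
  generalize a^k = y at *
  have hy0 : 0 < y := by linarith
  have e : y + a * y⁻¹ ≤ D ↔ y^2 + a ≤ D*y := by
    rw [← mul_le_mul_iff_left₀ hy0]
    have : (y + a * y⁻¹) * y = y^2 + a := by field_simp
    rw [this]
  rw [e]
  have hx' : (D - s)/2 ≤ 1 := by
    by_contra h
    nlinarith
  have f : y^2 + a - D*y = (y - (D+s)/2) * (y - (D-s)/2) := by nlinarith
  have g : 0 < y - (D-s)/2 := by linarith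
  constructor
  · intro h
    nlinarith
  · intro h
    by_contra h'
    have := mul_pos (show 0 < y - (D+s)/2 by linarith) g
    linarith

/-- For integers `n ≥ 2` and `k ≥ 1`, with `Δ = α + 1 + (n−2)(α−1)(α−α^{−1})/(p(q−2))`:
`n_k < n ≤ n_{k+1}` if and only if `k = ⌊log_α((Δ + √(Δ² − 4α))/2)⌋`. -/
theorem k_formula (p q : ℕ) (hp : 3 ≤ p) (hq : 3 ≤ q)
    (hpq : 4 < (p - 2) * (q - 2)) (n : ℤ) (hn : 2 ≤ n) (k : ℕ) (hk : 1 ≤ k)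
    (Δ : ℝ)
    (hΔ : Δ = hypAlpha p q + 1 +
      ((n : ℝ) - 2) * (hypAlpha p q - 1) * (hypAlpha p q - (hypAlpha p q)⁻¹) /
        ((p : ℝ) * ((q : ℝ) - 2))) :
    (hypN p q k < (n : ℝ) ∧ (n : ℝ) ≤ hypN p q (k + 1)) ↔
      (k : ℤ) = ⌊Real.logb (hypAlpha p q)
        ((Δ + Real.sqrt (Δ ^ 2 - 4 * hypAlpha p q)) / 2)⌋ := by
  obtain ⟨ha, hM⟩ := aux_alpha p q hp hq hpq
  obtain ⟨j, rfl⟩ : ∃ j, k = j + 1 := ⟨k - 1, by omega⟩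
  obtain ⟨z, hz⟩ := aux_isint p q ha _ hM j
  obtain ⟨w, hw⟩ := aux_isint p q ha _ hM (j+1)
  have hN : ∀ i : ℕ, 1 ≤ i → (hypN p q i ≤ (n:ℝ) - 1 ↔
      (hypAlpha p q)^i ≤ (Δ + Real.sqrt (Δ ^ 2 - 4 * hypAlpha p q)) / 2) := by
    intro i hi
    have hb : (hypAlpha p q)⁻¹ < 1 := inv_lt_one_of_one_lt₀ ha
    have hp' : (3:ℝ) ≤ p := by exact_mod_cast hp
    have hq' : (3:ℝ) ≤ q := by exact_mod_cast hq
    have hn' : (2:ℝ) ≤ n := by exact_mod_cast hn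
    have hP : 0 < (p:ℝ) * ((q:ℝ) - 2) := mul_pos (by linarith) (by linarith)
    have hQ : 0 < (hypAlpha p q - 1) * (hypAlpha p q - (hypAlpha p q)⁻¹) :=
      mul_pos (by linarith) (by linarith)
    have hD : hypAlpha p q + 1 ≤ Δ := by
      rw [hΔ, mul_assoc]
      have := div_nonneg (mul_nonneg (show 0 ≤ (n:ℝ) - 2 by linarith) hQ.le) hP.le
      linarith
    rw [aux_root _ _ ha hD i hi, aux_closed p q ha, hΔ, mul_assoc]
    generalize (hypAlpha p q - 1) * (hypAlpha p q - (hypAlpha p q)⁻¹) = Q at *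
    generalize (p:ℝ) * ((q:ℝ) - 2) = P at *
    generalize hypAlpha p q ^ i + hypAlpha p q * (hypAlpha p q)⁻¹ ^ i = y
    have h1 : 1 + P / Q * (y - (hypAlpha p q + 1)) ≤ (n:ℝ) - 1 ↔
        P * (y - (hypAlpha p q + 1)) / Q ≤ (n:ℝ) - 2 := by
      rw [div_mul_eq_mul_div]
      constructor <;> intro h <;> linarith
    have h2 : y ≤ hypAlpha p q + 1 + ((n:ℝ) - 2) * Q / P ↔
        y - (hypAlpha p q + 1) ≤ ((n:ℝ) - 2) * Q / P := by
      constructor <;> intro h <;> linarith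
    rw [h1, h2, div_le_iff₀ hQ, le_div_iff₀ hP, mul_comm P]
  have k1 := hN (j+1) (by omega)
  have k2 := hN (j+1+1) (by omega)
  have hx : 0 < (Δ + Real.sqrt (Δ ^ 2 - 4 * hypAlpha p q)) / 2 := by
    have := (hN 1 le_rfl).1 (by
      obtain ⟨-, -⟩ := And.intro k1 k2
      have h1 : hypAlpha p q * (hypAlpha p q)⁻¹ = 1 := mul_inv_cancel₀ (by linarith)
      have hn' : (2:ℝ) ≤ n := by exact_mod_cast hn
      rw [aux_closed p q ha]
      simp only [pow_one, h1, sub_self, mul_zero]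
      linarith)
    rw [pow_one] at this
    linarith
  rw [eq_comm, Int.floor_eq_iff, Real.le_logb_iff_rpow_le ha hx]
  have e : (((j+1:ℕ):ℤ):ℝ) + 1 = ((j+1+1:ℕ):ℝ) := by push_cast; ring
  rw [e, Real.logb_lt_iff_lt_rpow ha hx, Int.cast_natCast, Real.rpow_natCast, Real.rpow_natCast,
    ← k1, ← not_le, ← not_le, ← k2, hz, hw, not_le]
  have c1 : (z:ℝ) < n ↔ (z:ℝ) ≤ (n:ℝ) - 1 := by
    constructor
    · intro h
      have h' : z < n := by exact_mod_cast h
      have : z ≤ n - 1 := by omega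
      exact_mod_cast this
    · intro h; linarith
  have c2 : (n:ℝ) ≤ w ↔ ¬ (w:ℝ) ≤ (n:ℝ) - 1 := by
    constructor
    · intro h; linarith
    · intro h
      by_contra h'
      have h2 : w < n := by exact_mod_cast not_le.1 h'
      have : w ≤ n - 1 := by omega
      exact h (by exact_mod_cast this)
  rw [c1, c2]
end

section
/- Let β > 1 be an irrational real number, let c ≥ 0 be an integer, let N ≥ 1 be an integer, and let m ≥ 0 be an integer. Then ⌊(m+c)β⌋ − ⌊cβ⌋ ≤ N − 1 < ⌊(m+1+c)β⌋ − ⌊cβ⌋ holds if and only if m = ⌊ (N − {cβ}) / β ⌋, where {x} = x − ⌊x⌋ denotes the fractional part. -/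
/-- Floor inversion: for irrational `β > 1`, integers `c ≥ 0`, `N ≥ 1`, `m ≥ 0`,
`⌊(m+c)β⌋ − ⌊cβ⌋ ≤ N − 1 < ⌊(m+1+c)β⌋ − ⌊cβ⌋` holds iff `m = ⌊(N − {cβ})/β⌋`. -/
theorem floor_inversion (β : ℝ) (hirr : Irrational β) (hβ : 1 < β)
    (c N m : ℤ) (hc : 0 ≤ c) (hN : 1 ≤ N) (hm : 0 ≤ m) :
    (⌊((m : ℝ) + (c : ℝ)) * β⌋ - ⌊(c : ℝ) * β⌋ ≤ N - 1 ∧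
      N - 1 < ⌊((m : ℝ) + 1 + (c : ℝ)) * β⌋ - ⌊(c : ℝ) * β⌋) ↔
    m = ⌊((N : ℝ) - Int.fract ((c : ℝ) * β)) / β⌋ := by
  have key : ∀ k : ℤ, 0 ≤ k → k = 0 ∨ (k : ℝ) * β ≠ ((N + ⌊(c : ℝ) * β⌋ : ℤ) : ℝ) := by
    intro k _
    by_cases h : k = 0
    · exact Or.inl h
    · exact Or.inr ((hirr.intCast_mul h).ne_int _)
  have hβ0 : 0 < β := by linarith
  have h1 : (m + c : ℝ) * β ≠ N + ⌊(c : ℝ) * β⌋ := by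
    rcases key (m + c) (by omega) with h | h
    · have hm0 : m = 0 := by omega
      have hc0 : c = 0 := by omega
      subst hm0 hc0
      have : (1 : ℝ) ≤ N := by exact_mod_cast hN
      intro h'
      simp at h'
      linarith
    · push_cast at h
      exact h
  have h2 : (m + 1 + c : ℝ) * β ≠ N + ⌊(c : ℝ) * β⌋ := by
    rcases key (m + 1 + c) (by omega) with h | h
    · omega
    · push_cast at h
      exact h
  have e1 : ⌊((m : ℝ) + (c : ℝ)) * β⌋ - ⌊(c : ℝ) * β⌋ ≤ N - 1 ↔
      (m + c : ℝ) * β < N + ⌊(c : ℝ) * β⌋ := by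
    have := @Int.floor_lt ℝ _ _ _ (N + ⌊(c : ℝ) * β⌋) (((m : ℝ) + (c : ℝ)) * β)
    push_cast at this
    rw [← this]
    omega
  have e2 : N - 1 < ⌊((m : ℝ) + 1 + (c : ℝ)) * β⌋ - ⌊(c : ℝ) * β⌋ ↔
      (N + ⌊(c : ℝ) * β⌋ : ℝ) ≤ (m + 1 + c : ℝ) * β := by
    have := @Int.le_floor ℝ _ _ _ (N + ⌊(c : ℝ) * β⌋) (((m : ℝ) + 1 + (c : ℝ)) * β)
    push_cast at this
    rw [← this]
    omega
  rw [e1, e2, eq_comm (a := m), Int.floor_eq_iff, le_div_iff₀ hβ0, div_lt_iff₀ hβ0, Int.fract]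
  constructor
  · rintro ⟨a, b⟩
    have b' := lt_of_le_of_ne b h2.symm
    constructor <;> linarith
  · rintro ⟨a, b⟩
    exact ⟨lt_of_le_of_ne (by linarith) h1, by linarith⟩
end

section
/- Let p ≥ 5 and q ≥ 5 be integers, and for k ≥ 1 set w_k = γ_k − (p−3)γ_{k−1} (the length of the word W_k). Then for every k ≥ 1, the fractional part of w_k·β equals α^{−k}(α − β); that is, {w_k β} = α^{−k}(α − β). -/
theorem aux_wk (A a b P Q : ℝ) (Pz Qz : ℤ) (hP : P = Pz) (hQ : Q = Qz) (hAa : A * a = 1)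
    (hs : A + a = P * Q - 2) (hb : P * b = A + 1) (hba : b * a = Q - b) (hne : A - a ≠ 0)
    (n : ℕ) :
    (∃ z : ℤ, ((A ^ (n+1) - a ^ (n+1)) / (A - a) - (P - 1) * ((A ^ n - a ^ n) / (A - a))) * b
      - a ^ (n+1) * (A - b) = z) ∧
    (∃ z : ℤ, ((A ^ (n+2) - a ^ (n+2)) / (A - a) - (P - 1) * ((A ^ (n+1) - a ^ (n+1)) / (A - a))) * b
      - a ^ (n+2) * (A - b) = z) := by
  induction n with
  | zero =>
    have h1 : (A ^ 1 - a ^ 1) / (A - a) = 1 := by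
      rw [pow_one, pow_one, div_self hne]
    have h2 : (A ^ 2 - a ^ 2) / (A - a) = P * Q - 2 := by
      rw [div_eq_iff hne, ← hs]; ring
    have h0 : (A ^ 0 - a ^ 0) / (A - a) = 0 := by simp
    refine ⟨⟨Qz - 1, ?_⟩, ⟨(Pz * Qz - 2) * (Qz - 1) - 1, ?_⟩⟩
    · simp only [zero_add]
      rw [h1, h0]; push_cast; rw [← hQ]
      linear_combination hba - hAa
    · simp only [zero_add]
      rw [h1, h2]; push_cast; rw [← hQ, ← hP]
      linear_combination (a - 1) * hba - a * hAa + (Q - 1) * hs + (Q - 1) * hb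
  | succ n ih =>
    obtain ⟨⟨x, hx⟩, ⟨y, hy⟩⟩ := ih
    refine ⟨⟨y, hy⟩, ⟨(Pz * Qz - 2) * y - x, ?_⟩⟩
    have key : ∀ m : ℕ, (A ^ (m+2) - a ^ (m+2)) / (A - a) =
        (P * Q - 2) * ((A ^ (m+1) - a ^ (m+1)) / (A - a)) - (A ^ m - a ^ m) / (A - a) := by
      intro m
      rw [← mul_div_assoc, ← sub_div, ← hs]
      congr 1
      linear_combination (a ^ m - A ^ m) * hAa
    have ka : a ^ (n+1+2) = (P * Q - 2) * a ^ (n+2) - a ^ (n+1) := by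
      rw [← hs]
      linear_combination (-a ^ (n+1)) * hAa
    have k1 := key (n+1)
    have k0 := key n
    push_cast
    rw [← hx, ← hy, ← hP, ← hQ, k1, ka]
    simp only [show n + 1 + 1 = n + 2 from rfl]
    generalize (A ^ (n+2) - a ^ (n+2)) / (A - a) = g2 at *
    generalize (A ^ (n+1) - a ^ (n+1)) / (A - a) = g1 at *
    generalize (A ^ n - a ^ n) / (A - a) = g0 at *
    linear_combination (-(P - 1) * b) * k0

/-- For `p ≥ 5`, `q ≥ 5` and `k ≥ 1`, with `w_k = γ_k − (p−3)γ_{k−1}`: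
`{w_k β} = α^{−k}(α − β)`. -/
theorem fract_wk_beta (p q : ℕ) (hp : 5 ≤ p) (hq : 5 ≤ q) (k : ℕ) (hk : 1 ≤ k) :
    Int.fract ((hypGamma p q k - ((p : ℝ) - 3) * hypGamma p q (k - 1)) * hypBeta p q) =
      (hypAlpha p q)⁻¹ ^ k * (hypAlpha p q - hypBeta p q) := by
  obtain ⟨n, rfl⟩ : ∃ n, k = n + 1 := ⟨k - 1, by omega⟩
  have hp' : (5:ℝ) ≤ p := by exact_mod_cast hp
  have hq' : (5:ℝ) ≤ q := by exact_mod_cast hq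
  simp only [hypGamma, Nat.add_sub_cancel]
  obtain ⟨P, hP⟩ : ∃ P : ℝ, P = (p:ℝ) - 2 := ⟨_, rfl⟩
  obtain ⟨Q, hQ⟩ : ∃ Q : ℝ, Q = (q:ℝ) - 2 := ⟨_, rfl⟩
  have hP3 : 3 ≤ P := by linarith
  have hQ3 : 3 ≤ Q := by linarith
  have hPQ : 9 ≤ P * Q := by nlinarith
  obtain ⟨s, hs⟩ : ∃ s : ℝ, s = Real.sqrt ((P * Q - 2) ^ 2 - 4) := ⟨_, rfl⟩
  have hs0 : 0 ≤ s := hs ▸ Real.sqrt_nonneg _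
  have hs2 : s ^ 2 = (P * Q - 2) ^ 2 - 4 := by
    rw [hs]; exact Real.sq_sqrt (by nlinarith)
  have hA : hypAlpha p q = ((P * Q - 2) + s) / 2 := by
    simp only [hypAlpha, ← hP, ← hQ, hs]
  have hB : hypBeta p q = (P * Q + s) / (2 * P) := by
    simp only [hypBeta, ← hP, ← hQ, hs]
    congr 3; ring
  generalize hypAlpha p q = A at *
  generalize hypBeta p q = b at *
  have hA1 : 3 < A := by rw [hA]; linarith
  have hA0 : A ≠ 0 := by linarith
  have hquad : A ^ 2 + 2 * A + 1 = P * Q * A := by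
    rw [hA]; linear_combination hs2 / 4
  have hb : P * b = A + 1 := by
    rw [hB, hA]; field_simp; ring
  have hAa : A * A⁻¹ = 1 := mul_inv_cancel₀ hA0
  have ha0 : 0 < A⁻¹ := by positivity
  have ha1 : A⁻¹ < 1 := inv_lt_one_of_one_lt₀ (by linarith)
  generalize A⁻¹ = a at *
  have hsum : A + a = P * Q - 2 := by
    apply mul_left_cancel₀ hA0
    linear_combination hquad + hAa
  have hba : b * a = Q - b := by
    apply mul_left_cancel₀ (show P ≠ 0 by linarith)
    linear_combination (a + 1) * hb + hAa + hsum
  have hbpos : 0 < b := by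
    by_contra h
    nlinarith
  have hbA : b < A := by nlinarith
  obtain ⟨⟨z, hz⟩, -⟩ := aux_wk A a b P Q (p - 2) (q - 2) (by push_cast; exact hP)
    (by push_cast; exact hQ) hAa hsum hb hba (by linarith) n
  rw [Int.fract_eq_iff]
  refine ⟨?_, ?_, z, ?_⟩
  · exact mul_nonneg (by positivity) (by linarith)
  · have h1 : a ^ n ≤ 1 := pow_le_one₀ ha0.le ha1.le
    have h2 : a * (A - b) < 1 := by nlinarith
    have h3 : 0 ≤ a * (A - b) := mul_nonneg ha0.le (by linarith)
    calc a ^ (n+1) * (A - b) = a ^ n * (a * (A - b)) := by ring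
      _ ≤ 1 * (a * (A - b)) := mul_le_mul_of_nonneg_right h1 h3
      _ < 1 := by linarith
  · rw [← hz, hP]; ring
end

section
/- Let n be an integer with n > p(q−2), and let k ≥ 1 be the index with n_k < n ≤ n_{k+1}. Then 0 < ε_{p,q}(n) < 22. -/
lemma hyp_facts (p q : ℕ) (hp : 3 ≤ p) (hq : 3 ≤ q) (hpq : 4 < (p - 2) * (q - 2)) :
    (5 : ℝ) ≤ ((p : ℝ) - 2) * ((q : ℝ) - 2) ∧ (p : ℝ) - 2 ≤ ((p : ℝ) - 2) * ((q : ℝ) - 2) ∧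
    (13 / 5 : ℝ) ≤ hypAlpha p q ∧
    (hypAlpha p q + 1) ^ 2 = ((p : ℝ) - 2) * ((q : ℝ) - 2) * hypAlpha p q ∧
    hypBeta p q * ((p : ℝ) - 2) = hypAlpha p q + 1 ∧ 0 < hypBeta p q := by
  have hp' : (3 : ℝ) ≤ p := by exact_mod_cast hp
  have hq' : (3 : ℝ) ≤ q := by exact_mod_cast hq
  have hs : (5 : ℝ) ≤ ((p : ℝ) - 2) * ((q : ℝ) - 2) := by
    have h : 5 ≤ (p - 2) * (q - 2) := hpq
    have h2 : ((5 : ℕ) : ℝ) ≤ (((p - 2) * (q - 2) : ℕ) : ℝ) := by exact_mod_cast h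
    rw [Nat.cast_mul, Nat.cast_sub (by omega), Nat.cast_sub (by omega)] at h2
    exact_mod_cast h2
  have hb : hypBeta p q * ((p : ℝ) - 2) = hypAlpha p q + 1 := by
    unfold hypBeta hypAlpha
    have h1 : ((p : ℝ) - 2) ≠ 0 := by linarith
    have h2 : ((p : ℝ) - 2) ^ 2 * ((q : ℝ) - 2) ^ 2 -
        4 * (((p : ℝ) - 2) * ((q : ℝ) - 2)) = (((p : ℝ) - 2) * ((q : ℝ) - 2) - 2) ^ 2 - 4 := by
      ring
    rw [h2]
    field_simp
    ring
  have ha : (13 / 5 : ℝ) ≤ hypAlpha p q := by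
    unfold hypAlpha
    have : (11 / 5 : ℝ) ≤ Real.sqrt ((((p : ℝ) - 2) * ((q : ℝ) - 2) - 2) ^ 2 - 4) := by
      apply Real.le_sqrt_of_sq_le
      nlinarith
    linarith
  refine ⟨hs, by nlinarith, ha, ?_, hb, ?_⟩
  · unfold hypAlpha
    have h := Real.sq_sqrt (show 0 ≤ (((p : ℝ) - 2) * ((q : ℝ) - 2) - 2) ^ 2 - 4 by nlinarith)
    linear_combination h / 4
  · have h1 : 0 < (p : ℝ) - 2 := by linarith
    by_contra hcon
    push Not at hcon
    nlinarith

noncomputable def hypU (a c : ℝ) (k : ℕ) : ℝ := (a ^ k - c ^ k) / (a - c)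

lemma hypU_step {a c : ℝ} (h : a * c = 1) (hac : a - c ≠ 0) (k : ℕ) :
    hypU a c (k + 2) = (a + c) * hypU a c (k + 1) - hypU a c k := by
  unfold hypU
  field_simp
  linear_combination (a ^ k - c ^ k) * (-h)

lemma hypU_c {a c : ℝ} (h : a * c = 1) (hac : a - c ≠ 0) (k : ℕ) :
    c * hypU a c (k + 1) = hypU a c k + c ^ (k + 1) := by
  unfold hypU
  field_simp
  linear_combination (a ^ k - c ^ k) * h

lemma hypU_int {a c : ℝ} (h : a * c = 1) (hac : a - c ≠ 0) (t : ℤ) (ht : a + c = t) (k : ℕ) :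
    ∃ u v : ℤ, hypU a c k = u ∧ hypU a c (k + 1) = v := by
  induction k with
  | zero => exact ⟨0, 1, by simp [hypU], by simp [hypU, hac]⟩
  | succ k ih =>
    obtain ⟨u, v, hu, hv⟩ := ih
    refine ⟨v, t * v - u, hv, ?_⟩
    rw [hypU_step h hac, hu, hv, ht]
    push_cast; ring

lemma hypN_step (p q : ℕ) (ha : 1 < hypAlpha p q) (k : ℕ) :
    hypN p q (k + 1) = hypN p q k +
      p * ((q : ℝ) - 2) * hypU (hypAlpha p q) (hypAlpha p q)⁻¹ k := by
  unfold hypN hypU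
  generalize hypAlpha p q = a at *
  have hc1 : a⁻¹ < 1 := inv_lt_one_of_one_lt₀ ha
  have h : a * a⁻¹ = 1 := mul_inv_cancel₀ (by linarith)
  generalize a⁻¹ = c at *
  have h1 : a - 1 ≠ 0 := by linarith
  have h2 : c - 1 ≠ 0 := by linarith
  have h3 : a - c ≠ 0 := by linarith
  field_simp
  ring

lemma hypN_int (p q : ℕ) (a c b : ℝ) (haa : a = hypAlpha p q) (hcc : c = (hypAlpha p q)⁻¹)
    (ha : 1 < a) (hb : b ≠ 0) (h : a * c = 1)
    (hac : a - c ≠ 0) (ht : a + c = ((p : ℝ) - 2) * ((q : ℝ) - 2) - 2)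
    (hQ : ((q : ℝ) - 2) / b = 1 + c) (k : ℕ) :
    ∃ m M : ℤ, hypN p q k = m ∧ hypN p q (k + 1) / b = 1 / b + M + p * (1 - c ^ k) / (a - 1) := by
  have ht' : a + c = ((((p : ℤ) - 2) * ((q : ℤ) - 2) - 2 : ℤ) : ℝ) := by rw [ht]; push_cast; ring
  have h1 : a - 1 ≠ 0 := by linarith
  have hst : ∀ k, hypN p q (k + 1) = hypN p q k + p * ((q : ℝ) - 2) * hypU a c k := by
    intro k; rw [haa, hcc]; exact hypN_step p q (haa ▸ ha) k
  have h0 : hypN p q 0 = 1 := by simp [hypN]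
  induction k with
  | zero =>
    refine ⟨1, 0, by simp [h0], ?_⟩
    rw [hst, h0]; simp [hypU]
  | succ k ih =>
    obtain ⟨m, M, hm, hM⟩ := ih
    obtain ⟨u, v, hu, hv⟩ := hypU_int h hac _ ht' k
    refine ⟨m + p * (q - 2) * u, M + p * (v + u), ?_, ?_⟩
    · rw [hst, hm, hu]; push_cast; ring
    · have hc := hypU_c h hac k
      have e : (p : ℝ) * (1 - c ^ (k + 1)) / (a - 1) =
          p * (1 - c ^ k) / (a - 1) + p * c ^ (k + 1) := by
        field_simp
        linear_combination (-(p : ℝ) * c ^ k) * h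
      rw [hst, add_div, hM, e]
      have e2 : (p : ℝ) * ((q : ℝ) - 2) * hypU a c (k + 1) / b =
          p * hypU a c (k + 1) * (((q : ℝ) - 2) / b) := by ring
      rw [e2, hQ]
      push_cast
      rw [← hu, ← hv]
      linear_combination (p : ℝ) * hc

set_option maxHeartbeats 2000000 in
/-- For `n > p(q−2)` with `n_k < n ≤ n_{k+1}`: `0 < ε_{p,q}(n) < 22`. -/
theorem epsilon_bounds (p q : ℕ) (hp : 3 ≤ p) (hq : 3 ≤ q)
    (hpq : 4 < (p - 2) * (q - 2))
    (n : ℤ) (hn : (p : ℝ) * ((q : ℝ) - 2) < (n : ℝ))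
    (k : ℕ) (hk : 1 ≤ k) (hn1 : hypN p q k < (n : ℝ)) (hn2 : (n : ℝ) ≤ hypN p q (k + 1))
    (l j n' φ ε : ℝ)
    (hl : l = (hypN p q (k + 1) - hypN p q k) / (p : ℝ))
    (hj : j = (⌊((n : ℝ) - hypN p q k - 1) / l⌋ : ℝ))
    (hn' : n' = (n : ℝ) - hypN p q k - j * l)
    (hφ : φ = if p = 3 then
        (if n' ≤ (l + (hypN p q (k + 2) - hypN p q (k + 1)) / (p : ℝ)) / ((q : ℝ) - 2) then
          (hypAlpha p q)⁻¹ ^ k * (hypAlpha p q - 1)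
        else
          (hypAlpha p q)⁻¹ ^ k * (hypAlpha p q * (hypAlpha p q - 1) + 1))
      else if p = 4 then (hypAlpha p q)⁻¹ ^ k * (hypAlpha p q - 1)
      else (hypAlpha p q)⁻¹ ^ k * (hypAlpha p q - hypBeta p q))
    (hε : ε = 2 * (n : ℝ) / hypBeta p q +
      2 * (⌊1 + 1 / hypBeta p q + (p : ℝ) / (hypAlpha p q - 1) +
          (p : ℝ) * (hypAlpha p q)⁻¹ ^ k / ((hypAlpha p q)⁻¹ - 1) +
          φ / hypBeta p q + (hypAlpha p q)⁻¹ ^ k * j - (n : ℝ) / hypBeta p q⌋ : ℝ) -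
      2 * (⌊((n : ℝ) - hypN p q k) / (hypN p q (k + 1) - hypN p q k)⌋ : ℝ)) :
    0 < ε ∧ ε < 22 := by
  obtain ⟨hs, hPs, ha, hsa, hbP, hb⟩ := hyp_facts p q hp hq hpq
  have hp' : (3 : ℝ) ≤ p := by exact_mod_cast hp
  have hq' : (3 : ℝ) ≤ q := by exact_mod_cast hq
  have hN := hypN_int p q (hypAlpha p q) (hypAlpha p q)⁻¹ (hypBeta p q) rfl rfl
  have hst := hypN_step p q (by linarith)
  have hac : hypAlpha p q * (hypAlpha p q)⁻¹ = 1 := mul_inv_cancel₀ (by linarith)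
  have hc0 : 0 < (hypAlpha p q)⁻¹ := inv_pos.mpr (by linarith)
  generalize hypAlpha p q = a at *
  generalize hypBeta p q = b at *
  generalize a⁻¹ = c at *
  have hc1 : c ≤ 5 / 13 := by nlinarith only [hac, ha, hc0]
  have hacn : a - c ≠ 0 := by linarith
  have ht : a + c = ((p : ℝ) - 2) * ((q : ℝ) - 2) - 2 := by
    have : a * (a + c) = a * (((p : ℝ) - 2) * ((q : ℝ) - 2) - 2) := by linear_combination hsa + hac
    exact mul_left_cancel₀ (by linarith) this
  have hQ : ((q : ℝ) - 2) / b = 1 + c := by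
    rw [div_eq_iff hb.ne']
    have hPa : ((p : ℝ) - 2) ≠ 0 := by linarith
    apply mul_left_cancel₀ hPa
    linear_combination (-(1 + c)) * hbP + (-1 : ℝ) * ht - hac
  have hN := hN (by linarith) hb.ne' hac hacn ht hQ
  have ht' : a + c = ((((p : ℤ) - 2) * ((q : ℤ) - 2) - 2 : ℤ) : ℝ) := by rw [ht]; push_cast; ring
  -- index shift
  obtain ⟨i, rfl⟩ : ∃ i, k = i + 1 := ⟨k - 1, by omega⟩
  obtain ⟨m, M, hm, hM⟩ := hN (i + 1)
  obtain ⟨u, v, hu, hv⟩ := hypU_int hac hacn _ ht' i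
  have hstep := hypU_step hac hacn i
  have hU0 : 0 ≤ hypU a c i := by
    unfold hypU
    apply div_nonneg _ (by linarith)
    have : c ^ i ≤ a ^ i := pow_le_pow_left₀ hc0.le (by linarith) i
    linarith
  have hU1 : 0 < hypU a c (i + 1) := by
    unfold hypU
    apply div_pos _ (by linarith)
    have : c ^ (i + 1) < a ^ (i + 1) := pow_lt_pow_left₀ (by linarith) hc0.le (by omega)
    linarith
  have hU1' : 1 ≤ hypU a c (i + 1) := by
    rw [hv] at hU1 ⊢
    exact_mod_cast hU1
  have hN1 := hst (i + 1)
  have hN2 := hst (i + 2)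
  have hl' : l = ((q : ℝ) - 2) * hypU a c (i + 1) := by
    rw [hl, hN1]; field_simp; ring
  have hl1 : 1 ≤ l := by rw [hl']; nlinarith only [hU1', hq']
  have hl0 : 0 < l := by linarith
  have hd : hypN p q (i + 1 + 1) - hypN p q (i + 1) = p * l := by rw [hl', hN1]; ring
  have hnm : (1 : ℝ) ≤ n - hypN p q (i + 1) := by
    rw [hm] at hn1 ⊢
    have : m < n := by exact_mod_cast hn1
    have : m + 1 ≤ n := this
    have : ((m + 1 : ℤ) : ℝ) ≤ n := by exact_mod_cast this
    push_cast at this; linarith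
  have hj0 : 0 ≤ j := by
    rw [hj]
    have : 0 ≤ ⌊((n : ℝ) - hypN p q (i + 1) - 1) / l⌋ :=
      Int.floor_nonneg.mpr (div_nonneg (by linarith) hl0.le)
    exact_mod_cast this
  have hjp : j ≤ p - 1 := by
    rw [hj]
    have : ⌊((n : ℝ) - hypN p q (i + 1) - 1) / l⌋ < (p : ℤ) := by
      rw [Int.floor_lt, div_lt_iff₀ hl0]
      push_cast
      linarith
    have : ⌊((n : ℝ) - hypN p q (i + 1) - 1) / l⌋ + 1 ≤ (p : ℤ) := this
    have : ((⌊((n : ℝ) - hypN p q (i + 1) - 1) / l⌋ + 1 : ℤ) : ℝ) ≤ ((p : ℤ) : ℝ) := by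
      exact_mod_cast this
    push_cast at this; linarith
  have hP0 : 0 < (p : ℝ) - 2 := by linarith
  have hbinv : 1 / b = ((p : ℝ) - 2) / (a + 1) := by
    rw [← hbP]; field_simp
  have hbi : 1 / b ≤ 1 + c := by
    rw [← hQ]
    apply div_le_div_of_nonneg_right _ hb.le
    linarith
  have hbi0 : 0 < 1 / b := by positivity
  set x := c ^ (i + 1) with hx
  have hx0 : 0 < x := by positivity
  have hxc : x ≤ c := by
    rw [hx, pow_succ]
    have : c ^ i ≤ 1 := pow_le_one₀ hc0.le (by linarith)
    nlinarith only [this, hc0]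
  have hp4 : p = 4 → 3 ≤ a := by
    intro h4
    subst h4
    by_contra hcon
    push Not at hcon
    push_cast at hsa
    have : (5 : ℝ) ≤ q := by
      have : 4 < q := by omega
      exact_mod_cast this
    nlinarith only [this, hsa, hcon, ha]
  have hp5 : p ≠ 3 → p ≠ 4 → 2 * b ≤ a := by
    intro h3 h4
    have h5 : 5 ≤ p := by omega
    have h5 : (5 : ℝ) ≤ p := by exact_mod_cast h5
    nlinarith only [h5, hb, hbP, ha]
  -- bounds on φ
  have hφ0 : 0 ≤ φ := by
    rw [hφ]
    split_ifs with h1 h2 h3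
    · exact mul_nonneg hx0.le (by linarith)
    · exact mul_nonneg hx0.le (by nlinarith only [ha])
    · exact mul_nonneg hx0.le (by linarith)
    · have := hp5 h1 h3
      exact mul_nonneg hx0.le (by linarith)
  have hφ2 : φ / b ≤ 2 := by
    rw [div_le_iff₀ hb]
    have key : ∀ y, 0 ≤ y → y ≤ 2 * b * a → x * y ≤ 2 * b := by
      intro y hy hy2
      calc x * y ≤ c * (2 * b * a) := mul_le_mul hxc hy2 hy hc0.le
        _ = 2 * b := by linear_combination 2 * b * hac
    rw [hφ]
    split_ifs with h1 h2 h3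
    · subst h1
      push_cast at hbP
      have : b = a + 1 := by linarith
      apply key _ (by linarith only [ha]); nlinarith only [this, ha]
    · subst h1
      push_cast at hbP
      have : b = a + 1 := by linarith
      apply key _ (by nlinarith only [ha]); nlinarith only [this, ha]
    · subst h3
      push_cast at hbP
      have : b = (a + 1) / 2 := by linarith
      apply key _ (by nlinarith only [ha]); nlinarith only [this, ha]
    · have h5 := hp5 h1 h3
      apply key _ (by linarith)
      have hb1 : 1 ≤ 2 * b := by
        rw [div_le_iff₀ hb] at hbi
        nlinarith only [hbi, hc1, hb]
      nlinarith only [hb1, ha, hb]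
  have hpa : (p : ℝ) / (a - 1) ≤ 5 := by
    rw [div_le_iff₀ (by linarith)]
    rcases le_or_gt p 7 with h7 | h7
    · have : (p : ℝ) ≤ 7 := by exact_mod_cast h7
      linarith
    · have : (8 : ℝ) ≤ p := by exact_mod_cast h7
      linarith
  have hc1' : (p : ℝ) * x / (c - 1) = - (p * x * a / (a - 1)) := by
    have h1 : c - 1 ≠ 0 := by linarith
    have h2 : a - 1 ≠ 0 := by linarith
    field_simp
    linear_combination hac
  have hxa : x * a ≤ 1 := by nlinarith only [hxc, hac, ha]
  have hlow : 0 ≤ (p : ℝ) / (a - 1) + p * x / (c - 1) := by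
    rw [hc1']
    have : (p : ℝ) / (a - 1) + -(p * x * a / (a - 1)) = p * (1 - x * a) / (a - 1) := by ring
    rw [this]
    exact div_nonneg (mul_nonneg (by linarith) (by linarith)) (by linarith)
  have hup : (p : ℝ) * x / (c - 1) + x * j ≤ 0 := by
    rw [hc1']
    have h1 : x * j ≤ x * p := mul_le_mul_of_nonneg_left (by linarith) hx0.le
    have h2 : x * p ≤ p * x * a / (a - 1) := by
      rw [le_div_iff₀ (by linarith)]
      have : 0 < x * p := by positivity
      nlinarith only [this]
    linarith
  have hφb : 0 ≤ φ / b := div_nonneg hφ0 hb.le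
  have hxj : 0 ≤ x * j := mul_nonneg hx0.le hj0
  have hpl : 0 < (p : ℝ) * l := by positivity
  have ht0 : 0 ≤ ⌊((n : ℝ) - hypN p q (i + 1)) / (p * l)⌋ :=
    Int.floor_nonneg.mpr (div_nonneg (by linarith) hpl.le)
  have ht0' : (0 : ℝ) ≤ ⌊((n : ℝ) - hypN p q (i + 1)) / (p * l)⌋ := by exact_mod_cast ht0
  rw [hd] at hε
  have e2 : 2 * (n : ℝ) / b = 2 * (n / b) := by ring
  rw [e2] at hε
  constructor
  · rcases lt_or_eq_of_le hn2 with hlt | heq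
    · have hfl : ⌊((n : ℝ) - hypN p q (i + 1)) / (p * l)⌋ = 0 := by
        rw [Int.floor_eq_zero_iff]
        refine ⟨div_nonneg (by linarith) hpl.le, ?_⟩
        rw [div_lt_one hpl]; linarith
      rw [hfl] at hε
      have := Int.lt_floor_add_one (1 + 1 / b + (p : ℝ) / (a - 1) + p * x / (c - 1) +
          φ / b + x * j - (n : ℝ) / b)
      push_cast at hε
      linarith
    · have hnn : (n : ℝ) - hypN p q (i + 1) = p * l := by rw [heq]; exact hd
      have hfl : ((n : ℝ) - hypN p q (i + 1)) / (p * l) = 1 := by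
        rw [hnn]; exact div_self hpl.ne'
      rw [hfl, Int.floor_one] at hε
      have hjj : j = p - 1 := by
        have : ⌊((n : ℝ) - hypN p q (i + 1) - 1) / l⌋ = (p : ℤ) - 1 := by
          rw [Int.floor_eq_iff, hnn]
          constructor
          · rw [le_div_iff₀ hl0]; push_cast; linarith
          · rw [div_lt_iff₀ hl0]; push_cast; linarith
        rw [hj, this]; push_cast; ring
      have hn'l : n' = l := by rw [hn', hnn, hjj]; ring
      have hφβ : 0 ≤ φ / b - x := by
        have : x * b ≤ φ := by
          rw [hφ]
          split_ifs with h1 h2 h3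
          · exfalso
            rw [hn'l, hN2, le_div_iff₀ (by linarith)] at h2
            have e : (hypN p q (i + 2) + p * ((q : ℝ) - 2) * hypU a c (i + 2) -
              hypN p q (i + 1 + 1)) / p = ((q : ℝ) - 2) * hypU a c (i + 2) := by
              have : i + 1 + 1 = i + 2 := rfl
              rw [this]; field_simp; ring
            have h2' : l * ((q : ℝ) - 2) ≤ l + ((q : ℝ) - 2) * hypU a c (i + 2) := by
              rw [← e]; exact h2
            subst h1
            push_cast at ht
            rw [hl', hstep, ht] at h2'
            have hQ0 : 0 < (q : ℝ) - 2 := by linarith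
            nlinarith only [h2', mul_pos hQ0 hU1, mul_nonneg hQ0.le hU0]
          · subst h1
            push_cast at hbP
            apply mul_le_mul_of_nonneg_left _ hx0.le
            nlinarith only [hbP, ha]
          · have := hp4 h3
            subst h3
            push_cast at hbP
            apply mul_le_mul_of_nonneg_left _ hx0.le
            linarith
          · have := hp5 h1 h3
            apply mul_le_mul_of_nonneg_left _ hx0.le
            linarith
        rw [sub_nonneg, le_div_iff₀ hb]; exact this
      have harg : 1 + 1 / b + (p : ℝ) / (a - 1) + p * x / (c - 1) +
          φ / b + x * j - (n : ℝ) / b = (φ / b - x) + ((1 - M : ℤ) : ℝ) := by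
        rw [heq, hM, hc1', hjj]
        have h2 : a - 1 ≠ 0 := by linarith
        push_cast
        field_simp
        ring
      rw [harg, Int.floor_add_intCast] at hε
      have hf0 : 0 ≤ ⌊φ / b - x⌋ := Int.floor_nonneg.mpr hφβ
      have hf0' : (0 : ℝ) ≤ ⌊φ / b - x⌋ := by exact_mod_cast hf0
      have hpx : 0 ≤ (p : ℝ) * (1 - x) / (a - 1) :=
        div_nonneg (mul_nonneg (by linarith) (by linarith)) (by linarith)
      rw [heq, hM] at hε
      push_cast at hε
      linarith
  · have := Int.floor_le (1 + 1 / b + (p : ℝ) / (a - 1) + p * x / (c - 1) +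
          φ / b + x * j - (n : ℝ) / b)
    linarith
end

section
/- Let n be an integer with n > n_4, and let k ≥ 4 be the index with n_k < n ≤ n_{k+1}. Then | ε_{p,q}(n) − 2·(1 + 1/β + p/(α−1)) | < 2.6. -/
lemma hyp_basic (p q : ℕ) (hp : 3 ≤ p) (hq : 3 ≤ q) (hpq : 4 < (p - 2) * (q - 2)) :
    2.6 < hypAlpha p q ∧
    (hypAlpha p q + 1) ^ 2 = ((p : ℝ) - 2) * ((q : ℝ) - 2) * hypAlpha p q ∧
    hypBeta p q = (hypAlpha p q + 1) / ((p : ℝ) - 2) ∧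
    (5 : ℝ) ≤ ((p : ℝ) - 2) * ((q : ℝ) - 2) := by
  have h5 : (5 : ℝ) ≤ ((p : ℝ) - 2) * ((q : ℝ) - 2) := by
    have : ((5 : ℕ) : ℝ) ≤ (((p - 2) * (q - 2) : ℕ) : ℝ) := by exact_mod_cast hpq
    rw [Nat.cast_mul, Nat.cast_sub (by omega), Nat.cast_sub (by omega)] at this
    exact_mod_cast this
  have hp' : (3 : ℝ) ≤ p := by exact_mod_cast hp
  have hs : hypAlpha p q = ((((p : ℝ) - 2) * ((q : ℝ) - 2) - 2) +
      Real.sqrt ((((p : ℝ) - 2) * ((q : ℝ) - 2) - 2) ^ 2 - 4)) / 2 := rfl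
  have hb : hypBeta p q = (((p : ℝ) - 2) * ((q : ℝ) - 2) +
      Real.sqrt ((((p : ℝ) - 2) * ((q : ℝ) - 2) - 2) ^ 2 - 4)) / (2 * ((p : ℝ) - 2)) := by
    unfold hypBeta
    congr 3
    ring_nf
  generalize hT : ((p : ℝ) - 2) * ((q : ℝ) - 2) = T at *
  have h1 : 0 ≤ (T - 2) ^ 2 - 4 := by nlinarith
  have h2 := Real.sq_sqrt h1
  have h3 : 2.2 < Real.sqrt ((T - 2) ^ 2 - 4) := by
    apply Real.lt_sqrt_of_sq_lt
    nlinarith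
  generalize Real.sqrt ((T - 2) ^ 2 - 4) = s at *
  refine ⟨?_, ?_, ?_, h5⟩
  · rw [hs]; linarith
  · rw [hs]; nlinarith
  · have : (p : ℝ) - 2 ≠ 0 := by linarith
    rw [hb, hs]; field_simp; ring

lemma hyp_int (a : ℝ) (t : ℤ) (ha : 1 < a) (h : a ^ 2 + 1 = t * a) (k : ℕ) :
    ∃ m : ℤ, a * (a ^ k + a⁻¹ ^ k - 2) = m * (a - 1) ^ 2 := by
  have key : ∀ k : ℕ, (∃ m : ℤ, a * (a ^ k + a⁻¹ ^ k - 2) = m * (a - 1) ^ 2) ∧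
      (∃ m : ℤ, a * (a ^ (k+1) + a⁻¹ ^ (k+1) - 2) = m * (a - 1) ^ 2) := by
    intro k
    have ha0 : a ≠ 0 := by linarith
    induction k with
    | zero => 
      refine ⟨⟨0, by norm_num⟩, ⟨1, ?_⟩⟩
      norm_num
      field_simp
      ring
    | succ k ih =>
      obtain ⟨⟨m0, h0⟩, ⟨m1, h1⟩⟩ := ih
      refine ⟨⟨m1, h1⟩, ⟨t * m1 - m0 + 2, ?_⟩⟩
      push_cast
      have ht : (t : ℝ) = a + a⁻¹ := by field_simp; linarith
      have hr : a ^ (k+1+1) + a⁻¹ ^ (k+1+1) =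
          (a + a⁻¹) * (a ^ (k+1) + a⁻¹ ^ (k+1)) - (a ^ k + a⁻¹ ^ k) := by
        have : a * a⁻¹ = 1 := mul_inv_cancel₀ ha0
        simp only [pow_succ]
        linear_combination (-(a^k) - a⁻¹^k) * this
      have e : a * (a + a⁻¹ - 2) = (a-1)^2 := by field_simp; ring
      rw [hr, ht]
      linear_combination (a + a⁻¹) * h1 - h0 + 2 * e
  exact (key k).1

lemma hypN_diff (p q k : ℕ) (ha : 1 < hypAlpha p q) :
    hypN p q (k+1) - hypN p q k = (p : ℝ) * (((q : ℝ) - 2) /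
      (hypAlpha p q - (hypAlpha p q)⁻¹) * ((hypAlpha p q) ^ k - (hypAlpha p q)⁻¹ ^ k)) := by
  unfold hypN
  generalize hypAlpha p q = a at *
  have h1 : a - 1 ≠ 0 := by linarith
  have h0 : a⁻¹ - 1 ≠ 0 := by
    have : a⁻¹ < 1 := inv_lt_one_of_one_lt₀ ha
    linarith
  have e1 : (a ^ (k+1) - 1) / (a - 1) = (a ^ k - 1) / (a - 1) + a ^ k := by
    field_simp; ring
  have e2 : (a⁻¹ ^ (k+1) - 1) / (a⁻¹ - 1) = (a⁻¹ ^ k - 1) / (a⁻¹ - 1) + a⁻¹ ^ k := by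
    rw [div_add' _ _ _ h0]; congr 1; ring
  rw [e1, e2]; ring

/-- the value of the floor argument at the end point -/
lemma hyp_end (a P Q b u v c : ℝ) (ha : 1 < a) (hP : 3 ≤ P)
    (hPQ : (a + 1) ^ 2 = (P - 2) * (Q - 2) * a) (hb : b = (a + 1) / (P - 2))
    (m : ℝ) (hm : a * (v + u - 2) = m * (a - 1) ^ 2) :
    1 + 1 / b + P / (a - 1) + P * u / (a⁻¹ - 1) + u * c + u * (P - 1)
      - (1 + (P * (Q - 2) / (a - a⁻¹)) * ((v * a - 1) / (a - 1) - (u * a⁻¹ - 1) / (a⁻¹ - 1))) / b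
      = 1 + u * (c - 1) - P * m := by
  have h1 : a - 1 ≠ 0 := by linarith
  have h2 : a + 1 ≠ 0 := by linarith
  have h3 : P - 2 ≠ 0 := by linarith
  have h4 : a ≠ 0 := by linarith
  have hQ : Q - 2 = (a + 1) ^ 2 / (a * (P - 2)) := by
    field_simp; linarith
  have hm' : m = a * (v + u - 2) / (a - 1) ^ 2 := by field_simp; linarith
  have e1 : a⁻¹ - 1 = - (a - 1) / a := by field_simp; ring
  have e2 : a - a⁻¹ = (a - 1) * (a + 1) / a := by field_simp; ring
  rw [hQ, hm', hb, e1, e2]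
  field_simp
  ring

set_option maxHeartbeats 1000000

/-- For `n > n_4` with `n_k < n ≤ n_{k+1}`, `k ≥ 4`: `|ε_{p,q}(n) − 2(1 + 1/β + p/(α−1))| < 2.6`. -/
theorem epsilon_asymptotic_bound (p q : ℕ) (hp : 3 ≤ p) (hq : 3 ≤ q)
    (hpq : 4 < (p - 2) * (q - 2))
    (n : ℤ) (hn : hypN p q 4 < (n : ℝ))
    (k : ℕ) (hk : 4 ≤ k) (hn1 : hypN p q k < (n : ℝ)) (hn2 : (n : ℝ) ≤ hypN p q (k + 1))
    (l j n' φ ε : ℝ)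
    (hl : l = (hypN p q (k + 1) - hypN p q k) / (p : ℝ))
    (hj : j = (⌊((n : ℝ) - hypN p q k - 1) / l⌋ : ℝ))
    (hn' : n' = (n : ℝ) - hypN p q k - j * l)
    (hφ : φ = if p = 3 then
        (if n' ≤ (l + (hypN p q (k + 2) - hypN p q (k + 1)) / (p : ℝ)) / ((q : ℝ) - 2) then
          (hypAlpha p q)⁻¹ ^ k * (hypAlpha p q - 1)
        else
          (hypAlpha p q)⁻¹ ^ k * (hypAlpha p q * (hypAlpha p q - 1) + 1))
      else if p = 4 then (hypAlpha p q)⁻¹ ^ k * (hypAlpha p q - 1)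
      else (hypAlpha p q)⁻¹ ^ k * (hypAlpha p q - hypBeta p q))
    (hε : ε = 2 * (n : ℝ) / hypBeta p q +
      2 * (⌊1 + 1 / hypBeta p q + (p : ℝ) / (hypAlpha p q - 1) +
          (p : ℝ) * (hypAlpha p q)⁻¹ ^ k / ((hypAlpha p q)⁻¹ - 1) +
          φ / hypBeta p q + (hypAlpha p q)⁻¹ ^ k * j - (n : ℝ) / hypBeta p q⌋ : ℝ) -
      2 * (⌊((n : ℝ) - hypN p q k) / (hypN p q (k + 1) - hypN p q k)⌋ : ℝ)) :
    |ε - 2 * (1 + 1 / hypBeta p q + (p : ℝ) / (hypAlpha p q - 1))| < 2.6 := by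
  obtain ⟨ha, hPQ, hb, h5⟩ := hyp_basic p q hp hq hpq
  have hP : (3 : ℝ) ≤ p := by exact_mod_cast hp
  have hQ : (3 : ℝ) ≤ q := by exact_mod_cast hq
  have hd := hypN_diff p q k (by linarith)
  have hd' := hypN_diff p q (k+1) (by linarith)
  have hNe : hypN p q (k+1) = 1 + ((p : ℝ) * ((q : ℝ) - 2) / (hypAlpha p q - (hypAlpha p q)⁻¹)) *
    (((hypAlpha p q) ^ k * hypAlpha p q - 1) / (hypAlpha p q - 1) -
      ((hypAlpha p q)⁻¹ ^ k * (hypAlpha p q)⁻¹ - 1) / ((hypAlpha p q)⁻¹ - 1)) := by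
    unfold hypN; rw [pow_succ, pow_succ]
  obtain ⟨m, hm⟩ := hyp_int (hypAlpha p q) (((p:ℤ)-2)*((q:ℤ)-2)-2) (by linarith)
    (by push_cast; linarith) k
  rw [show hypN p q (k+2) = hypN p q (k+1+1) from rfl, hd'] at hφ
  generalize hNk : hypN p q k = N at *
  generalize hNk1 : hypN p q (k+1) = N1 at *
  clear hn
  generalize hypBeta p q = b at *
  generalize hypAlpha p q = a at *
  have ha0 : 0 < a := by linarith
  have hab : a * a⁻¹ = 1 := mul_inv_cancel₀ ha0.ne'
  have huv : a⁻¹ ^ k * a ^ k = 1 := by rw [← mul_pow, inv_mul_cancel₀ ha0.ne', one_pow]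
  have hv4 : a ^ 4 ≤ a ^ k := pow_le_pow_right₀ (by linarith) hk
  have hu0 : 0 < a⁻¹ ^ k := by positivity
  rw [pow_succ, pow_succ] at hφ
  generalize a ^ k = v at *
  generalize a⁻¹ ^ k = u at *
  have hi0 : 0 < a⁻¹ := by positivity
  have hi1 : a⁻¹ < 1 := inv_lt_one_of_one_lt₀ (by linarith)
  have hu4 : u * a ^ 4 ≤ 1 := (mul_le_mul_of_nonneg_left hv4 hu0.le).trans huv.le
  have haa4 : a ≤ a ^ 4 := le_self_pow₀ (by linarith) (by norm_num)
  have ha2 : 6.76 < a ^ 2 := by nlinarith only [ha]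
  have ha4 : a ^ 4 = a ^ 2 * a ^ 2 := by ring
  have hva : a ≤ v := haa4.trans hv4
  have hua : u ≤ a⁻¹ := by
    rw [← one_div, le_div_iff₀ ha0]
    exact (mul_le_mul_of_nonneg_left haa4 hu0.le).trans hu4
  have hl' : l = ((q : ℝ) - 2) / (a - a⁻¹) * (v - u) := by
    rw [hl, hd]; field_simp
  have hl1 : 1 ≤ l := by
    rw [hl', div_mul_eq_mul_div, le_div_iff₀ (by linarith)]
    have := mul_nonneg (by linarith : (0:ℝ) ≤ q - 3) (by linarith : 0 ≤ v - u)
    linarith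
  have hdl : N1 - N = p * l := by rw [hd, hl']
  have hPle : (p : ℝ) * a ≤ a ^ 2 + 4 * a + 1 := by
    have := mul_nonneg (mul_nonneg (by linarith : (0:ℝ) ≤ p - 2) (by linarith : (0:ℝ) ≤ q - 3)) ha0.le
    nlinarith only [this, hPQ]
  have hpl : (p : ℝ) ≤ a + 5 := by nlinarith only [hPle, ha]
  have hb0 : 0 < b := by rw [hb]; apply div_pos <;> linarith
  -- the coefficient c
  obtain ⟨c, hc, hc0, hcle, hcend⟩ : ∃ c : ℝ, φ / b = u * c ∧ 0 ≤ c ∧ c ≤ a + 4 ∧ (n' = l → 1 ≤ c) := by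
    by_cases h3 : p = 3
    · subst h3
      rw [if_pos rfl] at hφ
      norm_num at hb hPQ
      split_ifs at hφ with hn3
      · refine ⟨(a - 1) / b, by rw [hφ]; ring, ?_, ?_, ?_⟩
        · apply div_nonneg <;> linarith
        · rw [div_le_iff₀ hb0, hb]; nlinarith only [ha]
        · intro hnl
          exfalso
          rw [hnl, le_div_iff₀ (by linarith)] at hn3
          have e3 : (((3:ℕ):ℝ) * (((q : ℝ) - 2) / (a - a⁻¹) * (v * a - u * a⁻¹))) / ((3:ℕ):ℝ)
            = ((q : ℝ) - 2) / (a - a⁻¹) * (v * a - u * a⁻¹) := by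
            push_cast; ring
          rw [e3] at hn3
          have hq2 : (q : ℝ) - 2 = a + a⁻¹ + 2 := by
            field_simp; linarith
          have hle : ((q : ℝ) - 2) / (a - a⁻¹) * (v * a - u * a⁻¹) ≤ (a + a⁻¹) * l := by
            rw [hl']
            have : 0 < ((q : ℝ) - 2) / (a - a⁻¹) := by apply div_pos <;> linarith
            have h7 : v * a - u * a⁻¹ ≤ (a + a⁻¹) * (v - u) := by
              have g1 : u * a ≤ 1 := (mul_le_mul_of_nonneg_left haa4 hu0.le).trans hu4
              have g2 := mul_le_mul_of_nonneg_left hva hi0.le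
              nlinarith only [g1, g2, hab]
            calc _ ≤ ((q : ℝ) - 2) / (a - a⁻¹) * ((a + a⁻¹) * (v - u)) :=
                  mul_le_mul_of_nonneg_left h7 this.le
              _ = _ := by ring
          rw [hq2] at hn3 hle
          nlinarith only [hn3, hle, hl1]
      · refine ⟨(a * (a - 1) + 1) / b, by rw [hφ]; ring, ?_, ?_, ?_⟩
        · exact div_nonneg (by nlinarith only [ha]) hb0.le
        · rw [div_le_iff₀ hb0, hb]; nlinarith only [ha]
        · intro _
          rw [le_div_iff₀ hb0, hb]; nlinarith only [ha]
    · rw [if_neg h3] at hφ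
      have hp4 : (4 : ℝ) ≤ p := by
        have : 4 ≤ p := by omega
        exact_mod_cast this
      have hbp : b * ((p:ℝ) - 2) = a + 1 := by
        rw [hb]; exact div_mul_cancel₀ _ (by linarith)
      split_ifs at hφ with h4
      · subst h4
        norm_num at hb hPQ hbp h5
        have hq5 : (5 : ℝ) ≤ q := by
          have : 5 ≤ q := by omega
          exact_mod_cast this
        have ha3 : 3 ≤ a := by
          have := mul_nonneg (by linarith : (0:ℝ) ≤ q - 5) ha0.le
          nlinarith only [this, hPQ, ha]
        refine ⟨(a - 1) / b, by rw [hφ]; ring, ?_, ?_, ?_⟩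
        · apply div_nonneg <;> linarith
        · rw [div_le_iff₀ hb0, hb]; nlinarith only [ha]
        · intro _
          rw [le_div_iff₀ hb0, hb]; linarith
      · have hp5 : (5 : ℝ) ≤ p := by
          have : 5 ≤ p := by omega
          exact_mod_cast this
        have h2b : 2 * b ≤ a := by
          have := mul_nonneg (by linarith : (0:ℝ) ≤ p - 5) hb0.le
          nlinarith only [this, hbp, ha]
        refine ⟨(a - b) / b, by rw [hφ]; ring, ?_, ?_, ?_⟩
        · apply div_nonneg <;> linarith
        · rw [div_le_iff₀ hb0]
          have := mul_le_mul_of_nonneg_left hpl hb0.le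
          nlinarith only [this, hbp, hb0]
        · intro _
          rw [le_div_iff₀ hb0]; linarith
  have hl0 : 0 < l := by linarith
  -- bounds for j
  have hj1 : -1 ≤ j := by
    rw [hj]
    have : (-1 : ℤ) ≤ ⌊((n : ℝ) - N - 1) / l⌋ := by
      rw [Int.le_floor, le_div_iff₀ hl0]; push_cast; linarith
    exact_mod_cast this
  have hj2 : j ≤ p - 1 := by
    rw [hj]
    have : ⌊((n : ℝ) - N - 1) / l⌋ < (p : ℤ) := by
      rw [Int.floor_lt, div_lt_iff₀ hl0]; push_cast; linarith
    have : ⌊((n : ℝ) - N - 1) / l⌋ ≤ (p : ℤ) - 1 := by omega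
    exact_mod_cast this
  have e1 : (p : ℝ) * u / (a⁻¹ - 1) = - (u * (p * a / (a - 1))) := by
    have h1 : a - 1 ≠ 0 := by linarith
    have : a⁻¹ - 1 = - (a - 1) / a := by field_simp; ring
    rw [this]; field_simp
  have e2 : (p : ℝ) * a / (a - 1) = p + p / (a - 1) := by
    have h1 : a - 1 ≠ 0 := by linarith
    field_simp; ring
  have hpa0 : 0 ≤ (p : ℝ) / (a - 1) := by apply div_nonneg <;> linarith
  have hlow : u * (p * a / (a - 1) + 1) < 0.3 := by
    have h1 : p * a / (a - 1) + 1 < 0.3 * a ^ 4 := by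
      rw [div_add_one (by linarith), div_lt_iff₀ (by linarith)]
      have h8 : 17.576 < a ^ 3 := by
        have : a ^ 3 = a ^ 2 * a := by ring
        rw [this]; nlinarith only [ha, ha2]
      have h10 : a + 5 < 0.3 * a ^ 3 * (a - 1) := by nlinarith only [h8, ha]
      have h11 := mul_lt_mul_of_pos_left h10 ha0
      nlinarith only [h11, hPle]
    have := mul_lt_mul_of_pos_left h1 hu0
    linarith
  have huc : u * (a + 4) < 1 := by
    have h1 : a + 4 < a ^ 4 := by nlinarith only [ha4, ha2, ha]
    exact (mul_lt_mul_of_pos_left h1 hu0).trans_le hu4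
  have huc' : u * c ≤ u * (a + 4) := mul_le_mul_of_nonneg_left hcle hu0.le
  have huc0 : 0 ≤ u * c := by positivity
  have huj1 : u * (-1) ≤ u * j := mul_le_mul_of_nonneg_left hj1 hu0.le
  have huj2 : u * j ≤ u * (p - 1) := mul_le_mul_of_nonneg_left hj2 hu0.le
  have hup : 0 ≤ u * (p / (a - 1)) := mul_nonneg hu0.le hpa0
  have hup' : 0 ≤ u * p := by positivity
  have hNN : 0 < N1 - N := by linarith
  rw [hc] at hε
  by_cases hend : (n : ℝ) = N1
  · have hδ : ⌊((n : ℝ) - N) / (N1 - N)⌋ = 1 := by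
      rw [hend, div_self hNN.ne']; exact Int.floor_one
    have hjp : j = p - 1 := by
      rw [hj]
      have : (p : ℤ) - 1 ≤ ⌊((n : ℝ) - N - 1) / l⌋ := by
        rw [Int.le_floor, le_div_iff₀ hl0]; push_cast; linarith
      have h9 : ((p : ℝ) - 1) ≤ (⌊((n : ℝ) - N - 1) / l⌋ : ℝ) := by exact_mod_cast this
      rw [hj] at hj2
      linarith
    have hc1 : 1 ≤ c := hcend (by rw [hn', hjp]; linarith)
    have hx := hyp_end a p q b u v c (by linarith) hP hPQ hb m hm
    rw [← hNe, ← hend] at hx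
    rw [hδ, hjp, hx] at hε
    have hfl : ⌊1 + u * (c - 1) - p * m⌋ = 1 - (p : ℤ) * m := by
      rw [Int.floor_eq_iff]; push_cast
      constructor
      · have := mul_nonneg hu0.le (by linarith : 0 ≤ c - 1)
        linarith
      · linarith
    rw [hfl] at hε
    push_cast at hε
    rw [e1, e2] at hx
    rw [e2] at hlow
    rw [abs_lt]
    have e5 : 2 * (n : ℝ) / b = 2 * (n / b) := by ring
    rw [e5] at hε
    constructor <;> linarith
  · have hlt : (n : ℝ) < N1 := lt_of_le_of_ne hn2 hend
    have hδ : ⌊((n : ℝ) - N) / (N1 - N)⌋ = 0 := by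
      rw [Int.floor_eq_zero_iff]
      constructor
      · apply div_nonneg <;> linarith
      · rw [div_lt_one hNN]; linarith
    rw [hδ] at hε
    have hf1 := Int.floor_le (1 + 1 / b + (p : ℝ) / (a - 1) + p * u / (a⁻¹ - 1) + u * c + u * j - n / b)
    have hf2 := Int.lt_floor_add_one (1 + 1 / b + (p : ℝ) / (a - 1) + p * u / (a⁻¹ - 1) + u * c + u * j - n / b)
    generalize (⌊1 + 1 / b + (p : ℝ) / (a - 1) + p * u / (a⁻¹ - 1) + u * c + u * j - n / b⌋) = F at *
    rw [e1, e2] at hf1 hf2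
    rw [e2] at hlow
    have e5 : 2 * (n : ℝ) / b = 2 * (n / b) := by ring
    rw [e5] at hε
    push_cast at hε
    rw [abs_lt]
    constructor <;> linarith
end

section
/- For all integers p ≥ 3 and q ≥ 3 with (p−2)(q−2) > 4, the following inequalities hold: 1/α < 0.4, 1/β < 1.4, p/(α−1) < 4.4, p/α² < 1.1, and each of the three quantities α^{−2}(α−1)/β, α^{−2}(α(α−1)+1)/β, and α^{−2}(α−β)/β is less than 2.8 (so that φ_2/β < 2.8 for every admissible value of φ_2). -/
/-- Uniform bounds: `1/α < 0.4`, `1/β < 1.4`, `p/(α−1) < 4.4`, `p/α² < 1.1`, and each of the three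
possible values of `φ_2/β` (namely `α^{−2}(α−1)/β`, `α^{−2}(α(α−1)+1)/β`, `α^{−2}(α−β)/β`)
is less than `2.8`. -/
theorem uniform_bounds (p q : ℕ) (hp : 3 ≤ p) (hq : 3 ≤ q)
    (hpq : 4 < (p - 2) * (q - 2)) :
    1 / hypAlpha p q < 0.4 ∧
    1 / hypBeta p q < 1.4 ∧
    (p : ℝ) / (hypAlpha p q - 1) < 4.4 ∧
    (p : ℝ) / (hypAlpha p q) ^ 2 < 1.1 ∧
    (hypAlpha p q)⁻¹ ^ 2 * (hypAlpha p q - 1) / hypBeta p q < 2.8 ∧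
    (hypAlpha p q)⁻¹ ^ 2 * (hypAlpha p q * (hypAlpha p q - 1) + 1) / hypBeta p q < 2.8 ∧
    (hypAlpha p q)⁻¹ ^ 2 * (hypAlpha p q - hypBeta p q) / hypBeta p q < 2.8 := by
  obtain ⟨a, rfl⟩ := Nat.exists_eq_add_of_le hp
  obtain ⟨b, rfl⟩ := Nat.exists_eq_add_of_le hq
  have e1 : 3 + a - 2 = a + 1 := by omega
  have e2 : 3 + b - 2 = b + 1 := by omega
  rw [e1, e2] at hpq
  have hN : (5 : ℝ) ≤ ((a : ℝ) + 1) * ((b : ℝ) + 1) := by exact_mod_cast hpq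
  have ha : (0 : ℝ) ≤ a := Nat.cast_nonneg a
  have hb : (0 : ℝ) ≤ b := Nat.cast_nonneg b
  have hPN : (a : ℝ) + 1 ≤ ((a : ℝ) + 1) * ((b : ℝ) + 1) := by nlinarith
  have hα : ((a : ℝ) + 1) * ((b : ℝ) + 1) - 2.4 ≤ hypAlpha (3 + a) (3 + b) := by
    unfold hypAlpha
    push_cast
    have c1 : (3 + (a : ℝ) - 2) = a + 1 := by ring
    have c2 : (3 + (b : ℝ) - 2) = b + 1 := by ring
    rw [c1, c2]
    generalize ((a : ℝ) + 1) * ((b : ℝ) + 1) = N at *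
    have : N - 2.8 ≤ Real.sqrt ((N - 2) ^ 2 - 4) := by
      apply Real.le_sqrt_of_sq_le
      nlinarith
    linarith
  have hβ : 0.72 ≤ hypBeta (3 + a) (3 + b) := by
    unfold hypBeta
    push_cast
    have c1 : (3 + (a : ℝ) - 2) = a + 1 := by ring
    have c2 : (3 + (b : ℝ) - 2) = b + 1 := by ring
    rw [c1, c2, ← mul_pow, le_div_iff₀ (by positivity)]
    generalize ((a : ℝ) + 1) * ((b : ℝ) + 1) = N at *
    have : N - 2.8 ≤ Real.sqrt (N ^ 2 - 4 * N) := by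
      apply Real.le_sqrt_of_sq_le
      nlinarith
    linarith
  push_cast
  generalize hypAlpha (3 + a) (3 + b) = α at *
  generalize hypBeta (3 + a) (3 + b) = β at *
  generalize ((a : ℝ) + 1) * ((b : ℝ) + 1) = N at *
  have h26 : 2.6 ≤ α := by linarith
  have hα0 : 0 < α := by linarith
  have hβ0 : 0 < β := by linarith
  have hα2 : 0 < α ^ 2 := by positivity
  have hinv : α⁻¹ ^ 2 = 1 / α ^ 2 := by rw [inv_pow, one_div]
  rw [hinv]
  have key : ∀ x : ℝ, x ≤ α ^ 2 → 1 / α ^ 2 * x / β < 2.8 := by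
    intro x hx
    rw [div_lt_iff₀ hβ0, one_div_mul_eq_div, div_lt_iff₀ hα2]
    nlinarith
  refine ⟨?_, ?_, ?_, ?_, key _ ?_, key _ ?_, key _ ?_⟩
  · rw [div_lt_iff₀ hα0]; linarith
  · rw [div_lt_iff₀ hβ0]; linarith
  · rw [div_lt_iff₀ (by linarith)]; linarith
  · rw [div_lt_iff₀ hα2]; nlinarith
  · nlinarith
  · nlinarith
  · nlinarith
end
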